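/- The dunce hat D is contractible (simply connected and homotopy equivalent to a point), but no triangulation of D is collapsible, since every edge of any triangulation of D is a face of at least two triangles, so there is no free face to start a collapse. -/

import Mathlib

open Geometry Set

noncomputable section

variable {E F : Type} [NormedAddCommGroup E] [NormedSpace ℝ E]
  [NormedAddCommGroup F] [NormedSpace ℝ F]

/-- A map is affine on the simplex spanned by the finite set `s`:
it preserves convex combinations of the points of `s`. -/
def AffineOnSimplex (φ : E → F) (s : Finset E) : Prop :=
  ∀ w : E → ℝ, (∀ x ∈ s, 0 ≤ w x) → (∑ x ∈ s, w x) = 1 →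
    φ (∑ x ∈ s, w x • x) = ∑ x ∈ s, w x • φ x

/-- A map is piecewise linear on a set `S` if `S` carries a finite simplicial complex
structure on whose simplices the map is affine. -/
def IsPLMapOn (φ : E → F) (S : Set E) : Prop :=
  ∃ K : SimplicialComplex ℝ E, K.faces.Finite ∧ K.space = S ∧
    ∀ s ∈ K.faces, AffineOnSimplex φ s

/-- `φ` is a PL homeomorphism from `S` onto `T`. -/
def IsPLHomeoOn (φ : E → F) (S : Set E) (T : Set F) : Prop :=
  Set.BijOn φ S T ∧ IsPLMapOn φ S ∧
    ∃ ψ : F → E, IsPLMapOn ψ T ∧ (∀ x ∈ S, ψ (φ x) = x) ∧ (∀ y ∈ T, φ (ψ y) = y)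

/-- Two sets (polyhedra) are PL homeomorphic. -/
def ArePLHomeo (S : Set E) (T : Set F) : Prop := ∃ φ : E → F, IsPLHomeoOn φ S T

/-- The boundary of the standard `d+1`-dimensional simplex: a standard PL `d`-sphere. -/
def stdSphere (d : ℕ) : Set (Fin (d + 2) → ℝ) :=
  {x ∈ stdSimplex ℝ (Fin (d + 2)) | ∃ i, x i = 0}

/-- `S` is a PL `d`-ball. -/
def IsPLBall (S : Set E) (d : ℕ) : Prop := ArePLHomeo S (stdSimplex ℝ (Fin (d + 1)))

/-- `S` is a PL `d`-sphere. -/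
def IsPLSphere (S : Set E) (d : ℕ) : Prop := ArePLHomeo S (stdSphere d)

namespace Geometry.SimplicialComplex

/-- A generic PL function on a simplicial complex: affine on each simplex and
injective on the vertices. -/
structure IsGenericPL (K : SimplicialComplex ℝ E) (f : E → ℝ) : Prop where
  affineOn : ∀ s ∈ K.faces, AffineOnSimplex f s
  injOn : Set.InjOn f K.vertices

/-- The closed star of a vertex: union of the closed simplices containing it. -/
def starSpace (K : SimplicialComplex ℝ E) (v : E) : Set E :=
  ⋃ s ∈ {s ∈ K.faces | v ∈ s}, convexHull ℝ (s : Set E)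

/-- The link of a vertex: union of the faces of the star not containing the vertex. -/
def linkSpace (K : SimplicialComplex ℝ E) (v : E) : Set E :=
  ⋃ s ∈ {s ∈ K.faces | v ∉ s ∧ ∃ t ∈ K.faces, v ∈ t ∧ s ⊆ t}, convexHull ℝ (s : Set E)

/-- The sublevel set of `f` at level `a`, inside the underlying space of `K`. -/
def sublevel (K : SimplicialComplex ℝ E) (f : E → ℝ) (a : ℝ) : Set E :=
  {x ∈ K.space | f x ≤ a}

/-- The superlevel set of `f` at level `a`. -/
def superlevel (K : SimplicialComplex ℝ E) (f : E → ℝ) (a : ℝ) : Set E :=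
  {x ∈ K.space | a ≤ f x}

/-- The lower link `lk⁻(v)` of a vertex. -/
def lowerLink (K : SimplicialComplex ℝ E) (f : E → ℝ) (v : E) : Set E :=
  {x ∈ K.linkSpace v | f x ≤ f v}

/-- The upper link `lk⁺(v)` of a vertex. -/
def upperLink (K : SimplicialComplex ℝ E) (f : E → ℝ) (v : E) : Set E :=
  {x ∈ K.linkSpace v | f v ≤ f x}

/-- A combinatorial `d`-manifold (without boundary): a finite simplicial complex,
pure of dimension `d`, in which the link of every vertex is a PL `(d-1)`-sphere. -/
structure IsCombinatorialManifold (K : SimplicialComplex ℝ E) (d : ℕ) : Prop where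
  finite : K.faces.Finite
  nonempty : K.faces.Nonempty
  pure : ∀ s ∈ K.faces, ∃ t ∈ K.faces, s ⊆ t ∧ t.card = d + 1
  linkSphere : ∀ v ∈ K.vertices, IsPLSphere (K.linkSpace v) (d - 1)

/-- `f` has a local PL chart at `v` in which it is given by the model function `g`. -/
def HasPLChartAt (K : SimplicialComplex ℝ E) (f : E → ℝ) (v : E) (d : ℕ)
    (g : (Fin d → ℝ) → ℝ) : Prop :=
  ∃ (N : Set E) (φ : E → Fin d → ℝ),
    N ⊆ K.space ∧ N ∈ nhdsWithin v K.space ∧ φ v = 0 ∧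
    IsPLHomeoOn φ N (Set.pi Set.univ fun _ : Fin d => Set.Icc (-1 : ℝ) 1) ∧
    ∀ x ∈ N, f x = f v + g (φ x)

/-- A point is strongly regular if `f` can be used as the last coordinate of a PL chart. -/
def StronglyRegularAt (K : SimplicialComplex ℝ E) (f : E → ℝ) (v : E) (d : ℕ) : Prop :=
  ∃ hd : 0 < d, K.HasPLChartAt f v d fun x => x ⟨d - 1, Nat.sub_lt hd one_pos⟩

/-- A vertex is non-degenerate critical of index `k` if in a local PL chart
`f = f(v) - |x₁| - ⋯ - |x_k| + |x_{k+1}| + ⋯ + |x_d|`. -/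
def NondegenerateCriticalAt (K : SimplicialComplex ℝ E) (f : E → ℝ) (v : E)
    (d k : ℕ) : Prop :=
  k ≤ d ∧ K.HasPLChartAt f v d fun x =>
    ∑ i : Fin d, if (i : ℕ) < k then -|x i| else |x i|

/-- A PL Morse function: a generic PL function all of whose vertices are strongly
regular or non-degenerate critical. -/
def IsPLMorse (K : SimplicialComplex ℝ E) (f : E → ℝ) (d : ℕ) : Prop :=
  K.IsGenericPL f ∧ ∀ v ∈ K.vertices,
    K.StronglyRegularAt f v d ∨ ∃ k, K.NondegenerateCriticalAt f v d k

end Geometry.SimplicialComplex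

end
noncomputable section
/-- Unit vectors: the vertices of the standard triangle. -/
def triVert (i : Fin 3) : Fin 3 → ℝ := fun j => if i = j then 1 else 0

/-- The point at parameter `t` on the directed edge from vertex `i` to vertex `j`
of the standard triangle. -/
def triSeg (i j : Fin 3) (t : ℝ) : Fin 3 → ℝ := (1 - t) • triVert i + t • triVert j

/-- The edge identifications of the dunce hat: the three directed boundary edges
`e₀e₁`, `e₁e₂`, `e₀e₂` are identified with each other (two coherently, one reversed,
realizing the boundary word `x·x·x⁻¹`). -/
def dunceRel (x y : ↥(stdSimplex ℝ (Fin 3))) : Prop :=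
  ∃ t ∈ Set.Icc (0 : ℝ) 1,
    ((x : Fin 3 → ℝ) = triSeg 0 1 t ∧ (y : Fin 3 → ℝ) = triSeg 1 2 t) ∨
    ((x : Fin 3 → ℝ) = triSeg 0 1 t ∧ (y : Fin 3 → ℝ) = triSeg 0 2 t)

/-- The dunce hat: the quotient of a solid triangle identifying all three boundary
edges, two coherently and one with reversed orientation. -/
def DunceHat : Type := Quot dunceRel

instance : TopologicalSpace DunceHat := instTopologicalSpaceQuot

/-- A finite family of faces collapses to a point: a sequence of elementary collapses,
each removing a free face together with the unique face properly containing it. -/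
inductive CollapsesToPoint {E : Type} : Set (Finset E) → Prop
  | point (v : E) : CollapsesToPoint {{v}}
  | step (F : Set (Finset E)) (s t : Finset E) (hs : s ∈ F) (ht : t ∈ F) (hst : s ⊂ t)
      (hfree : ∀ u ∈ F, s ⊂ u → u = t) (hprev : CollapsesToPoint (F \ {s, t})) :
      CollapsesToPoint F
end
open Geometry

/-! ### Coordinates on the dunce hat -/

/-- The point of the standard triangle with barycentric coordinates `(1 - a - b, a, b)`,
extended to all real `a`, `b` by clamping. -/
noncomputable def trianglePoint (a b : ℝ) : ↥(stdSimplex ℝ (Fin 3)) :=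
  ⟨![1 - max 0 (min 1 a) - max 0 (min (1 - max 0 (min 1 a)) b), max 0 (min 1 a),
      max 0 (min (1 - max 0 (min 1 a)) b)], by
    have h : max 0 (min 1 a) ≤ 1 := max_le zero_le_one (min_le_left _ _)
    have h' : max 0 (min (1 - max 0 (min 1 a)) b) ≤ 1 - max 0 (min 1 a) :=
      max_le (by linarith) (min_le_left _ _)
    refine ⟨fun i => ?_, by simp [Fin.sum_univ_three]; ring⟩
    fin_cases i
    · simp [h']
    · exact le_max_left _ _
    · exact le_max_left _ _⟩

/-- The image of `trianglePoint a b` in the dunce hat. -/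
noncomputable def hatPoint (a b : ℝ) : DunceHat := Quot.mk _ (trianglePoint a b)

lemma continuous_trianglePoint : Continuous fun p : ℝ × ℝ => trianglePoint p.1 p.2 := by
  refine Continuous.subtype_mk (continuous_pi fun i => ?_) _
  fin_cases i <;> simp <;> fun_prop

lemma Continuous.trianglePoint {X : Type*} [TopologicalSpace X] {f g : X → ℝ}
    (hf : Continuous f) (hg : Continuous g) : Continuous fun x => trianglePoint (f x) (g x) :=
  continuous_trianglePoint.comp (hf.prodMk hg)

lemma Continuous.hatPoint {X : Type*} [TopologicalSpace X] {f g : X → ℝ}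
    (hf : Continuous f) (hg : Continuous g) : Continuous fun x => hatPoint (f x) (g x) :=
  continuous_quot_mk.comp (hf.trianglePoint hg)

lemma continuous_triangle_coord (i : Fin 3) :
    Continuous fun y : ↥(stdSimplex ℝ (Fin 3)) => y i :=
  (continuous_apply i).comp continuous_subtype_val

lemma coe_trianglePoint {a b : ℝ} (ha : 0 ≤ a) (hb : 0 ≤ b) (hab : a + b ≤ 1) :
    (trianglePoint a b : Fin 3 → ℝ) = ![1 - a - b, a, b] := by
  have h1 : max 0 (min 1 a) = a := by rw [min_eq_right (by linarith), max_eq_right ha]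
  have h2 : max 0 (min (1 - a) b) = b := by rw [min_eq_right (by linarith), max_eq_right hb]
  change (trianglePoint a b).val = _
  simp only [trianglePoint, h1, h2]

lemma triangle_coord_nonneg (y : ↥(stdSimplex ℝ (Fin 3))) (i : Fin 3) :
    0 ≤ y i := y.2.1 i

lemma triangle_coord_sum (y : ↥(stdSimplex ℝ (Fin 3))) :
    y 0 + y 1 + y 2 = 1 := by
  have := y.2.2
  rwa [Fin.sum_univ_three] at this

lemma trianglePoint_coord (y : ↥(stdSimplex ℝ (Fin 3))) :
    trianglePoint (y 1) (y 2) = y := by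
  have h0 := triangle_coord_nonneg y 0
  have h1 := triangle_coord_nonneg y 1
  have h2 := triangle_coord_nonneg y 2
  have h := triangle_coord_sum y
  apply DFunLike.coe_injective
  rw [coe_trianglePoint h1 h2 (by linarith)]
  ext i
  fin_cases i
  · simp; linarith
  · rfl
  · rfl

lemma triSeg_zero_one (t : ℝ) : triSeg 0 1 t = ![1 - t, t, 0] := by
  ext i; fin_cases i <;> simp [triSeg, triVert]

lemma triSeg_one_two (t : ℝ) : triSeg 1 2 t = ![0, 1 - t, t] := by
  ext i; fin_cases i <;> simp [triSeg, triVert]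

lemma triSeg_zero_two (t : ℝ) : triSeg 0 2 t = ![1 - t, 0, t] := by
  ext i; fin_cases i <;> simp [triSeg, triVert]

lemma dunceRel_iff (x y : ↥(stdSimplex ℝ (Fin 3))) :
    dunceRel x y ↔ ∃ t ∈ Set.Icc (0 : ℝ) 1, x = trianglePoint t 0 ∧
      (y = trianglePoint (1 - t) t ∨ y = trianglePoint 0 t) := by
  refine exists_congr fun t => and_congr_right fun ht => ?_
  have h0 : (trianglePoint t 0 : Fin 3 → ℝ) = triSeg 0 1 t := by
    rw [coe_trianglePoint ht.1 le_rfl (by linarith [ht.2]), triSeg_zero_one, sub_zero]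
  have h1 : (trianglePoint (1 - t) t : Fin 3 → ℝ) = triSeg 1 2 t := by
    rw [coe_trianglePoint (by linarith [ht.2]) ht.1 (by linarith), triSeg_one_two]
    simp
  have h2 : (trianglePoint 0 t : Fin 3 → ℝ) = triSeg 0 2 t := by
    rw [coe_trianglePoint le_rfl ht.1 (by linarith [ht.2]), triSeg_zero_two]
    simp
  rw [← h0, ← h1, ← h2, DFunLike.coe_fn_eq, DFunLike.coe_fn_eq, DFunLike.coe_fn_eq]
  tauto

lemma hatPoint_edge {t : ℝ} (ht : t ∈ Set.Icc (0 : ℝ) 1) :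
    hatPoint t 0 = hatPoint (1 - t) t ∧ hatPoint t 0 = hatPoint 0 t :=
  ⟨Quot.sound ((dunceRel_iff _ _).2 ⟨t, ht, rfl, .inl rfl⟩),
    Quot.sound ((dunceRel_iff _ _).2 ⟨t, ht, rfl, .inr rfl⟩)⟩

lemma hatPoint_vertex : hatPoint 1 0 = hatPoint 0 0 ∧ hatPoint 0 1 = hatPoint 0 0 := by
  have h0 := hatPoint_edge (t := 0) (by simp)
  have h1 := hatPoint_edge (t := 1) (by simp)
  simp only [sub_zero, sub_self] at h0 h1
  exact ⟨h0.1.symm, h1.1.symm.trans h0.1.symm⟩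

/-- The condition for a function on the triangle to descend to the dunce hat. -/
def RespectsEdges {Z : Type*} (f : ↥(stdSimplex ℝ (Fin 3)) → Z) : Prop :=
  ∀ t ∈ Set.Icc (0 : ℝ) 1, f (trianglePoint t 0) = f (trianglePoint (1 - t) t) ∧
    f (trianglePoint t 0) = f (trianglePoint 0 t)

lemma RespectsEdges.eq_of_dunceRel {Z : Type*} {f : ↥(stdSimplex ℝ (Fin 3)) → Z}
    (hf : RespectsEdges f) (x y : ↥(stdSimplex ℝ (Fin 3))) (h : dunceRel x y) : f x = f y := by
  obtain ⟨t, ht, rfl, rfl | rfl⟩ := (dunceRel_iff x y).1 h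
  · exact (hf t ht).1
  · exact (hf t ht).2

/-! ### Contractibility -/

open unitInterval

lemma RespectsEdges.exists_homotopy {Z : Type*} [TopologicalSpace Z]
    {H : I → ↥(stdSimplex ℝ (Fin 3)) → Z}
    (hc : Continuous fun p : I × ↥(stdSimplex ℝ (Fin 3)) => H p.1 p.2)
    (hr : ∀ s, RespectsEdges (H s)) :
    ∃ F : C(I × DunceHat, Z), ∀ s y, F (s, Quot.mk _ y) = H s y := by
  let G : C(↥(stdSimplex ℝ (Fin 3)), C(I, Z)) :=
    ContinuousMap.curry ⟨fun p : ↥(stdSimplex ℝ (Fin 3)) × I => H p.2 p.1,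
      hc.comp continuous_swap⟩
  have hG : ∀ x y, dunceRel x y → G x = G y := fun x y h =>
    ContinuousMap.ext fun s => (hr s).eq_of_dunceRel x y h
  let G' : C(DunceHat, C(I, Z)) := ⟨Quot.lift G hG, continuous_quot_lift hG G.continuous⟩
  exact ⟨G'.uncurry.comp ⟨Prod.swap, continuous_swap⟩, fun s y => rfl⟩

/-- A disc whose boundary edges `e₁e₂` and `e₀e₂` are mapped to the vertex of the dunce hat:
the subtriangle spanned by `e₀`, `e₁` and the barycenter is mapped by the quotient map, and the
other two subtriangles of the barycentric subdivision are mapped to the singular edge. -/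
noncomputable def foldMap (y : ↥(stdSimplex ℝ (Fin 3))) : DunceHat :=
  if min (y 0) (y 1) ≤ y 2 then
    hatPoint (3 * min (y 0) (y 1)) 0
  else hatPoint (y 1 - y 2) (3 * y 2)

lemma foldMap_eq_of_le {y : ↥(stdSimplex ℝ (Fin 3))} (h0 : y 2 ≤ y 0)
    (h1 : y 2 ≤ y 1) :
    foldMap y = hatPoint (y 1 - y 2) (3 * y 2) := by
  have n2 := triangle_coord_nonneg y 2
  have hs := triangle_coord_sum y
  unfold foldMap
  split_ifs with h
  · rcases le_total (y 0) (y 1) with h01 | h01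
    · rw [min_eq_left h01] at h ⊢
      have e : y 0 = y 2 := le_antisymm h h0
      rw [e, (hatPoint_edge ⟨by linarith, by linarith⟩).1]
      congr 1; linarith
    · rw [min_eq_right h01] at h ⊢
      have e : y 1 = y 2 := le_antisymm h h1
      rw [e, (hatPoint_edge ⟨by linarith, by linarith⟩).2, sub_self]
  · rfl

lemma foldMap_eq_of_ge {y : ↥(stdSimplex ℝ (Fin 3))}
    (h : min (y 0) (y 1) ≤ y 2) :
    foldMap y = hatPoint (3 * min (y 0) (y 1)) 0 := if_pos h

lemma continuous_foldMap : Continuous foldMap := by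
  have h0 := continuous_triangle_coord 0
  have h1 := continuous_triangle_coord 1
  have h2 := continuous_triangle_coord 2
  refine Continuous.if_le (Continuous.hatPoint (continuous_const.mul (h0.min h1)) continuous_const)
    ((h1.sub h2).hatPoint (continuous_const.mul h2)) (h0.min h1) h2 fun y hy => ?_
  rw [← foldMap_eq_of_ge hy.le, foldMap_eq_of_le (hy.ge.trans (min_le_left _ _))
    (hy.ge.trans (min_le_right _ _))]

lemma foldMap_trianglePoint_of_le {a b : ℝ} (hb : 0 ≤ b) (h0 : b ≤ 1 - a - b) (h1 : b ≤ a) :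
    foldMap (trianglePoint a b) = hatPoint (a - b) (3 * b) := by
  have e := coe_trianglePoint (hb.trans h1) hb (by linarith)
  rw [foldMap_eq_of_le (by simpa [e] using h0) (by simpa [e] using h1)]
  simp [e]

lemma foldMap_trianglePoint_of_ge {a b : ℝ} (ha : 0 ≤ a) (hb : 0 ≤ b) (hab : a + b ≤ 1)
    (h : min (1 - a - b) a ≤ b) :
    foldMap (trianglePoint a b) = hatPoint (3 * min (1 - a - b) a) 0 := by
  have e := coe_trianglePoint ha hb hab
  rw [foldMap_eq_of_ge (by simpa [e] using h)]
  simp [e]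

/-- The first stage of the contraction, homotoping the identity to a map factoring through
a disc. -/
noncomputable def unfoldHomotopy (s : I) (y : ↥(stdSimplex ℝ (Fin 3))) : DunceHat :=
  foldMap (trianglePoint
    (y 1 + y 2 / 3 - 4 / 3 * s *
      min (min (y 0) (y 1)) (y 2))
    (y 2 / 3 + 8 / 3 * s *
      min (min (y 0) (y 1)) (y 2)))

/-- The vertical deformation of the triangle onto the union of its edges `e₁e₂` and `e₀e₂`,
followed by `foldMap`. -/
noncomputable def pushMap (s : I) (a b : ℝ) : DunceHat :=
  foldMap (trianglePoint (a - s * min (1 - a - b) a) (b + 2 * s * min (1 - a - b) a))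

/-- The second stage of the contraction, sliding the disc off to the vertex. -/
noncomputable def slideHomotopy (s : I) (y : ↥(stdSimplex ℝ (Fin 3))) : DunceHat :=
  if y 2 ≤ min (y 0) (y 1) then
    pushMap s (y 1 - y 2) (3 * y 2)
  else pushMap s (y 2 - min (y 0) (y 1)) 0

lemma pushMap_of_min_eq_zero (s : I) {a b : ℝ} (ha : 0 ≤ a) (hb : 0 ≤ b) (hab : a + b ≤ 1)
    (h : min (1 - a - b) a = 0) : pushMap s a b = hatPoint 0 0 := by
  unfold pushMap
  rw [h]
  simp only [mul_zero, sub_zero, add_zero]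
  rw [foldMap_trianglePoint_of_ge ha hb hab (by rw [h]; exact hb), h, mul_zero]

lemma pushMap_one {a b : ℝ} (ha : 0 ≤ a) (hb : 0 ≤ b) (hab : a + b ≤ 1) :
    pushMap 1 a b = hatPoint 0 0 := by
  unfold pushMap
  have hm : 0 ≤ min (1 - a - b) a := le_min (by linarith) ha
  have hm0 := min_le_left (1 - a - b) a
  have hm1 := min_le_right (1 - a - b) a
  set m := min (1 - a - b) a with hmdef
  have e : min (1 - (a - m) - (b + 2 * m)) (a - m) = 0 := by
    rcases min_cases (1 - a - b) a with h | h
    · rw [min_eq_left] <;> linarith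
    · rw [min_eq_right] <;> linarith
  rw [Set.Icc.coe_one, one_mul, mul_one, foldMap_trianglePoint_of_ge (by linarith) (by linarith)
    (by linarith) (by rw [e]; linarith), e, mul_zero]

lemma continuous_pushMap : Continuous fun p : I × ℝ × ℝ => pushMap p.1 p.2.1 p.2.2 :=
  continuous_foldMap.comp (Continuous.trianglePoint (by fun_prop) (by fun_prop))

lemma continuous_unfoldHomotopy :
    Continuous fun p : I × ↥(stdSimplex ℝ (Fin 3)) => unfoldHomotopy p.1 p.2 := by
  have h (i : Fin 3) := (continuous_triangle_coord i).comp (continuous_snd (X := I))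
  have h0 := h 0
  have h1 := h 1
  have h2 := h 2
  simp only [Function.comp_def] at h0 h1 h2
  exact continuous_foldMap.comp (Continuous.trianglePoint (by fun_prop) (by fun_prop))

lemma continuous_slideHomotopy :
    Continuous fun p : I × ↥(stdSimplex ℝ (Fin 3)) => slideHomotopy p.1 p.2 := by
  have h (i : Fin 3) := (continuous_triangle_coord i).comp (continuous_snd (X := I))
  have h0 := h 0
  have h1 := h 1
  have h2 := h 2
  simp only [Function.comp_def] at h0 h1 h2
  have c1 := continuous_pushMap.comp
    (continuous_fst.prodMk ((h1.sub h2).prodMk (continuous_const (y := (3 : ℝ)).mul h2)))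
  have c2 := continuous_pushMap.comp
    (continuous_fst.prodMk ((h2.sub (h0.min h1)).prodMk (continuous_const (y := (0 : ℝ)))))
  simp only [Function.comp_def] at c1 c2
  refine Continuous.if_le c1 c2 h2 (h0.min h1) fun ⟨s, y⟩ hy => ?_
  simp only at hy
  have n2 := triangle_coord_nonneg y 2
  have hs := triangle_coord_sum y
  have l0 := hy.le.trans (min_le_left _ _)
  have l1 := hy.le.trans (min_le_right _ _)
  have key : min (1 - (y 1 - y 2) - 3 * y 2)
      (y 1 - y 2) = 0 := by
    rw [show 1 - (y 1 - y 2) - 3 * y 2 =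
      y 0 - y 2 by linarith, min_sub_sub_right, ← hy, sub_self]
  simp only
  rw [pushMap_of_min_eq_zero s (by linarith) (by linarith) (by linarith) key, ← hy,
    pushMap_of_min_eq_zero s (by linarith) le_rfl (by linarith) (by simp)]

lemma unfoldHomotopy_of_min_eq_zero (s : I) (y : ↥(stdSimplex ℝ (Fin 3)))
    (h : min (min (y 0) (y 1)) (y 2) = 0 ∨ s = 0) :
    unfoldHomotopy s y = Quot.mk _ y := by
  have n0 := triangle_coord_nonneg y 0
  have n1 := triangle_coord_nonneg y 1
  have n2 := triangle_coord_nonneg y 2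
  have hs := triangle_coord_sum y
  have e : (s : ℝ) * min (min (y 0) (y 1)) (y 2) = 0 := by
    rcases h with h | h <;> simp [h]
  unfold unfoldHomotopy
  rw [mul_assoc, mul_assoc, e, mul_zero, mul_zero, sub_zero, add_zero,
    foldMap_trianglePoint_of_le (by linarith) (by linarith) (by linarith)]
  rw [add_sub_cancel_right, mul_div_cancel₀ _ three_ne_zero]
  exact congrArg (Quot.mk _) (trianglePoint_coord y)

lemma respectsEdges_unfoldHomotopy (s : I) : RespectsEdges (unfoldHomotopy s) := by
  intro t ht
  have e0 := coe_trianglePoint ht.1 le_rfl (by linarith [ht.2])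
  have e1 := coe_trianglePoint (a := 1 - t) (b := t) (by linarith [ht.2]) ht.1 (by linarith)
  have e2 := coe_trianglePoint le_rfl ht.1 (by linarith [ht.2])
  have h0 : 0 ≤ t := ht.1
  have h1 : 0 ≤ 1 - t := sub_nonneg.2 ht.2
  rw [unfoldHomotopy_of_min_eq_zero s _ (.inl (by simp [e0, h0, h1])),
    unfoldHomotopy_of_min_eq_zero s _ (.inl (by simp [e1, h0, ht.2])),
    unfoldHomotopy_of_min_eq_zero s _ (.inl (by simp [e2, h0, ht.2]))]
  exact hatPoint_edge ht

lemma respectsEdges_slideHomotopy (s : I) : RespectsEdges (slideHomotopy s) := by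
  intro t ht
  have e0 := coe_trianglePoint ht.1 le_rfl (by linarith [ht.2])
  have e1 := coe_trianglePoint (a := 1 - t) (b := t) (by linarith [ht.2]) ht.1 (by linarith)
  have e2 := coe_trianglePoint le_rfl ht.1 (by linarith [ht.2])
  have h0 : 0 ≤ t := ht.1
  have h1 : 0 ≤ 1 - t := sub_nonneg.2 ht.2
  have key : slideHomotopy s (trianglePoint t 0) = pushMap s t 0 := by
    simp [slideHomotopy, e0, h0, ht.2]
  rw [key]
  unfold slideHomotopy
  rcases eq_or_lt_of_le h0 with rfl | hpos
  · rw [sub_zero] at e1 ⊢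
    simp [e1, e2]
    rw [pushMap_of_min_eq_zero, pushMap_of_min_eq_zero] <;> simp
  · simp [e1, e2, ht.2, hpos]

lemma slideHomotopy_zero (y : ↥(stdSimplex ℝ (Fin 3))) :
    slideHomotopy 0 y = unfoldHomotopy 1 y := by
  have n0 := triangle_coord_nonneg y 0
  have n1 := triangle_coord_nonneg y 1
  have n2 := triangle_coord_nonneg y 2
  have hs := triangle_coord_sum y
  unfold slideHomotopy unfoldHomotopy pushMap
  simp only [Set.Icc.coe_zero, Set.Icc.coe_one, zero_mul, mul_zero, sub_zero, add_zero, mul_one]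
  split_ifs with h
  · rw [min_eq_right h]
    congr 2 <;> ring
  · rw [not_le] at h
    rw [min_eq_left h.le, foldMap_trianglePoint_of_le le_rfl]
    · rcases le_total (y 0) (y 1) with h01 | h01
      · rw [min_eq_left h01] at h ⊢
        rw [foldMap_trianglePoint_of_ge (by linarith) (by linarith) (by linarith)
          (min_le_of_left_le (by linarith)), min_eq_left (by linarith)]
        congr 1 <;> linarith
      · rw [min_eq_right h01] at h ⊢
        rw [foldMap_trianglePoint_of_ge (by linarith) (by linarith) (by linarith)
          (min_le_of_right_le (by linarith)), min_eq_right (by linarith)]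
        congr 1 <;> linarith
    · have := le_min n0 n1; linarith
    · linarith

lemma slideHomotopy_one (y : ↥(stdSimplex ℝ (Fin 3))) : slideHomotopy 1 y = hatPoint 0 0 := by
  have n0 := triangle_coord_nonneg y 0
  have n1 := triangle_coord_nonneg y 1
  have n2 := triangle_coord_nonneg y 2
  have hs := triangle_coord_sum y
  have hm := le_min n0 n1
  unfold slideHomotopy
  split_ifs with h
  · have h0 := h.trans (min_le_left _ _)
    have h1 := h.trans (min_le_right _ _)
    exact pushMap_one (by linarith) (by linarith) (by linarith)
  · exact pushMap_one (by linarith) le_rfl (by linarith)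

lemma contractibleSpace_dunceHat : ContractibleSpace DunceHat := by
  rw [contractible_iff_id_nullhomotopic]
  obtain ⟨F, hF⟩ := RespectsEdges.exists_homotopy continuous_unfoldHomotopy
    respectsEdges_unfoldHomotopy
  obtain ⟨G, hG⟩ := RespectsEdges.exists_homotopy continuous_slideHomotopy
    respectsEdges_slideHomotopy
  let g : C(DunceHat, DunceHat) := F.comp ((ContinuousMap.const _ 1).prodMk (.id _))
  refine ⟨hatPoint 0 0, ContinuousMap.Homotopic.trans (g := g) ⟨⟨F, ?_, fun _ => rfl⟩⟩
    ⟨⟨G, ?_, ?_⟩⟩⟩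
  · rintro ⟨y⟩
    exact (hF 0 y).trans (unfoldHomotopy_of_min_eq_zero 0 y (.inr rfl))
  · rintro ⟨y⟩
    exact (hG 0 y).trans ((slideHomotopy_zero y).trans (hF 1 y).symm)
  · rintro ⟨y⟩
    exact (hG 1 y).trans (slideHomotopy_one y)

/-! ### Winding numbers -/

open Topology

lemma Complex.eq_of_exp_eq {A : Type*} [TopologicalSpace A] [PreconnectedSpace A] {f : A → ℂ}
    (hf : Continuous f) (h : ∀ a b, Complex.exp (f a) = Complex.exp (f b)) (a b : A) :
    f a = f b :=
  Complex.isCoveringMap_exp.const_of_comp hf (fun a b => Subtype.ext (h a b)) a b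

lemma exists_continuous_log {A : Type*} [TopologicalSpace A] [SimplyConnectedSpace A]
    [LocallyPathConnectedSpace A] {f : A → ℂ} (hf : Continuous f) (h0 : ∀ a, f a ≠ 0) :
    ∃ L : A → ℂ, Continuous L ∧ ∀ a, Complex.exp (L a) = f a := by
  obtain ⟨a⟩ : Nonempty A := inferInstance
  obtain ⟨L, ⟨-, hL⟩, -⟩ := Complex.isCoveringMapOn_exp.existsUnique_continuousMap_lifts
    ⟨f, hf⟩ (a₀ := a) (Complex.exp_log (h0 a)) h0
  exact ⟨L, L.continuous, congrFun hL⟩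

/-- A loop of nonzero complex numbers that is null-homotopic has a periodic logarithm. -/
lemma exists_periodic_log {G : I × ℝ → ℂ} (hG : Continuous G) (h0 : ∀ p, G p ≠ 0)
    (hconst : ∀ θ, G (0, θ) = G (0, 0)) (hper : ∀ t θ, G (t, θ + 2 * Real.pi) = G (t, θ)) :
    ∃ L : ℝ → ℂ, Continuous L ∧ (∀ θ, Complex.exp (L θ) = G (1, θ)) ∧
      ∀ θ, L (θ + 2 * Real.pi) = L θ := by
  have hcl : Continuous fun p : ℝ × ℝ => G (Set.projIcc 0 1 zero_le_one p.1, p.2) :=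
    hG.comp ((continuous_projIcc.comp continuous_fst).prodMk continuous_snd)
  obtain ⟨L, hLc, hL⟩ := exists_continuous_log hcl fun _ => h0 _
  have hbase (θ θ' : ℝ) : L (0, θ) = L (0, θ') :=
    Complex.eq_of_exp_eq (f := fun θ => L (0, θ)) (by fun_prop)
      (fun θ θ' => by simp [hL, hconst θ, hconst θ']) θ θ'
  refine ⟨fun θ => L (1, θ), by fun_prop, fun θ => by simp [hL], fun θ => ?_⟩
  have := Complex.eq_of_exp_eq (f := fun t : ℝ => L (t, θ + 2 * Real.pi) - L (t, θ))
    (by fun_prop) (fun t t' => by simp [Complex.exp_sub, hL, hper, h0]) 1 0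
  simp only [hbase (θ + 2 * Real.pi) θ, sub_self] at this
  exact sub_eq_zero.1 this

/-- A loop which never points in the direction opposite to `exp (θ * I)` is not null-homotopic
in the punctured plane. -/
lemma not_nullhomotopic_of_mem_slitPlane {G : I × ℝ → ℂ} (hG : Continuous G)
    (h0 : ∀ p, G p ≠ 0) (hconst : ∀ θ, G (0, θ) = G (0, 0))
    (hper : ∀ t θ, G (t, θ + 2 * Real.pi) = G (t, θ))
    (hs : ∀ θ : ℝ, G (1, θ) * Complex.exp (-(θ * Complex.I)) ∈ Complex.slitPlane) : False := by
  obtain ⟨L, hLc, hL, hLper⟩ := exists_periodic_log hG h0 hconst hper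
  have hc : Continuous fun θ : ℝ => G (1, θ) * Complex.exp (-(θ * Complex.I)) := by fun_prop
  have hone (θ : ℝ) : Complex.exp (L θ - θ * Complex.I -
      Complex.log (G (1, θ) * Complex.exp (-(θ * Complex.I)))) = 1 := by
    have := h0 (1, θ)
    have := Complex.exp_ne_zero (θ * Complex.I)
    rw [Complex.exp_sub, Complex.exp_sub, Complex.exp_log (Complex.slitPlane_ne_zero (hs θ)), hL,
      Complex.exp_neg]
    field_simp
  have := Complex.eq_of_exp_eq ((hLc.sub (by fun_prop)).sub (hc.clog hs))
    (fun θ θ' => (hone θ).trans (hone θ').symm) (0 + 2 * Real.pi) 0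
  simp only [Pi.sub_apply] at this
  rw [hLper, hper] at this
  have e : Complex.exp (-(((0 + 2 * Real.pi : ℝ) : ℂ) * Complex.I)) = 1 := by
    rw [Complex.exp_eq_one_iff]
    exact ⟨-1, by push_cast; ring⟩
  rw [e] at this
  simp [Real.pi_ne_zero] at this

/-- There is no continuous injection from a neighborhood in three-space to the plane. -/
lemma not_injOn_of_continuousOn_nhds {F : ℝ × ℝ × ℝ → ℂ} {U : Set (ℝ × ℝ × ℝ)} (hU : U ∈ 𝓝 0)
    (hc : ContinuousOn F U) : ¬ Set.InjOn F U := by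
  intro hinj
  obtain ⟨ε, hε, hball⟩ := Metric.mem_nhds_iff.1 hU
  let s : I × ℝ → ℝ × ℝ × ℝ := fun p => (ε / 2 * (p.1 * Real.cos p.2),
    ε / 2 * (p.1 * Real.sin p.2), ε / 2 * (1 - p.1))
  have hsc : Continuous s := by fun_prop
  have hsU (p : I × ℝ) : s p ∈ U ∧ -s p ∈ U := by
    have key (c : ℝ) (hc : |c| ≤ 1) : |ε / 2 * c| < ε := by
      rw [abs_mul, abs_of_pos (half_pos hε)]
      nlinarith
    have h1 := p.1.2.1
    have h2 := p.1.2.2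
    have hp : |(p.1 : ℝ)| ≤ 1 := by rwa [abs_of_nonneg h1]
    have : ‖s p‖ < ε := by
      simp only [s, Prod.norm_def, Real.norm_eq_abs]
      refine max_lt (key _ ?_) (max_lt (key _ ?_) (key _ ?_))
      · rw [abs_mul]; exact mul_le_one₀ hp (abs_nonneg _) (Real.abs_cos_le_one _)
      · rw [abs_mul]; exact mul_le_one₀ hp (abs_nonneg _) (Real.abs_sin_le_one _)
      · rw [abs_le]; constructor <;> linarith
    exact ⟨hball (by simpa using this), hball (by simpa using this)⟩
  have hs0 (p : I × ℝ) : s p ≠ -s p := by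
    intro h
    rw [self_eq_neg] at h
    simp only [s, Prod.mk_eq_zero, mul_eq_zero, half_pos hε |>.ne', false_or] at h
    obtain ⟨h1, h2, h3⟩ := h
    have h3 : (p.1 : ℝ) = 1 := by linarith
    simp only [h3, one_ne_zero, false_or] at h1 h2
    have := Real.sin_sq_add_cos_sq p.2
    simp [h1, h2] at this
  let G : I × ℝ → ℂ := fun p => F (s p) - F (-s p)
  have hG : Continuous G := (hc.comp_continuous hsc fun p => (hsU p).1).sub
    (hc.comp_continuous hsc.neg fun p => (hsU p).2)
  have hG0 (p : I × ℝ) : G p ≠ 0 := fun h =>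
    hs0 p (hinj (hsU p).1 (hsU p).2 (sub_eq_zero.1 h))
  have hodd (θ : ℝ) : G (1, θ + Real.pi) = -G (1, θ) := by
    have : s (1, θ + Real.pi) = -s (1, θ) := by simp [s]
    simp only [G, this, neg_neg, neg_sub]
  obtain ⟨L, hLc, hL, hLper⟩ := exists_periodic_log hG hG0 (by simp [G, s]) (by simp [G, s])
  have hshift : ∀ θ, Complex.exp (L (θ + Real.pi) - L θ) = -1 := fun θ => by
    rw [Complex.exp_sub, hL, hL, hodd, neg_div, div_self (hG0 _)]
  have := Complex.eq_of_exp_eq (f := fun θ : ℝ => L (θ + Real.pi) - L θ) (by fun_prop)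
    (fun θ θ' => by simp only [hshift]) (0 + Real.pi) 0
  have h2 := hLper 0
  rw [two_mul, ← add_assoc] at h2
  simp only [h2] at this
  have h3 : L (0 + Real.pi) - L 0 = 0 := by linear_combination -this / 2
  have h4 := hshift 0
  rw [h3, Complex.exp_zero] at h4
  norm_num at h4

/-! ### Points encircled by essential loops -/

/-- Arbitrarily close to `x` there are loops avoiding `x` that cannot be contracted in a fixed
neighborhood of `x` while avoiding `x`. -/
def HasEssentialLoops {X : Type*} [TopologicalSpace X] (x : X) : Prop :=
  ∃ U ∈ 𝓝 x, ∀ N ∈ 𝓝 x, ∃ γ : ℝ → X, Continuous γ ∧ (∀ θ, γ (θ + 2 * Real.pi) = γ θ) ∧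
    (∀ θ, γ θ ∈ N ∧ γ θ ≠ x) ∧
    ∀ H : I × ℝ → X, Continuous H → (∀ θ, H (1, θ) = γ θ) → (∀ θ, H (0, θ) = H (0, 0)) →
      (∀ t θ, H (t, θ + 2 * Real.pi) = H (t, θ)) → ∃ p, H p ∈ U → H p = x

lemma HasEssentialLoops.of_homeomorph {X Y : Type*} [TopologicalSpace X] [TopologicalSpace Y]
    (e : Y ≃ₜ X) {y : Y} (h : HasEssentialLoops (e y)) : HasEssentialLoops y := by
  obtain ⟨U, hU, h⟩ := h
  refine ⟨e ⁻¹' U, e.continuous.continuousAt hU, fun N hN => ?_⟩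
  obtain ⟨γ, hγ, hper, hmem, hH⟩ := h (e.symm ⁻¹' N)
    (e.symm.continuous.continuousAt.preimage_mem_nhds (by simpa using hN))
  refine ⟨e.symm ∘ γ, e.symm.continuous.comp hγ, fun θ => congrArg e.symm (hper θ),
    fun θ => ⟨(hmem θ).1, fun h => (hmem θ).2 (by simp [← h])⟩,
    fun H hHc h1 h0 hp => ?_⟩
  obtain ⟨p, hp⟩ := hH (e ∘ H) (e.continuous.comp hHc) (fun θ => by simp [h1])
    (fun θ => congrArg e (h0 θ)) (fun t θ => congrArg e (hp t θ))
  exact ⟨p, fun h => e.injective (hp h)⟩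

/-- A criterion for essential loops by means of a function with an isolated zero. -/
lemma HasEssentialLoops.of_slitPlane {X : Type*} [TopologicalSpace X] {x : X} {ρ : X → ℂ}
    (hρ : Continuous ρ) (hx : ρ x = 0) {U : Set X} (hU : U ∈ 𝓝 x)
    (hUx : ∀ y ∈ U, ρ y = 0 → y = x)
    (hγ : ∀ N ∈ 𝓝 x, ∃ γ : ℝ → X, Continuous γ ∧ (∀ θ, γ (θ + 2 * Real.pi) = γ θ) ∧
      ∀ θ : ℝ, γ θ ∈ N ∧ ρ (γ θ) * Complex.exp (-(θ * Complex.I)) ∈ Complex.slitPlane) :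
    HasEssentialLoops x := by
  refine ⟨U, hU, fun N hN => ?_⟩
  obtain ⟨γ, hγc, hper, h⟩ := hγ N hN
  refine ⟨γ, hγc, hper, fun θ => ⟨(h θ).1, fun hθ => ?_⟩, fun H hH h1 h0 hHper => ?_⟩
  · have := (h θ).2
    rw [hθ, hx, zero_mul] at this
    exact Complex.slitPlane_ne_zero this rfl
  · by_contra! hne
    exact not_nullhomotopic_of_mem_slitPlane (hρ.comp hH)
      (fun p hp => (hne p).2 (hUx _ (hne p).1 hp)) (fun θ => congrArg ρ (h0 θ))
      (fun t θ => congrArg ρ (hHper t θ)) (fun θ => by simpa [h1] using (h θ).2)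

lemma HasEssentialLoops.exists_mem_segment {E : Type*} [NormedAddCommGroup E] [NormedSpace ℝ E]
    {S V : Set E} {p : S} (hp : HasEssentialLoops p) (hV : Convex ℝ V) (hVS : V ⊆ S)
    (hVp : V ∈ 𝓝[S] (p : E)) :
    ∃ ε > 0, ∃ γ : ℝ → E, Continuous γ ∧ (∀ θ, γ θ ∈ V ∩ Metric.ball (p : E) ε ∧ γ θ ≠ p) ∧
      ∀ q ∈ V ∩ Metric.ball (p : E) ε, ∃ θ, (p : E) ∈ segment ℝ q (γ θ) := by
  obtain ⟨U, hU, h⟩ := hp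
  obtain ⟨ε, hε, hεU⟩ := Metric.mem_nhds_iff.1 hU
  have hVp' : (Subtype.val ⁻¹' V : Set S) ∈ 𝓝 p := by
    rwa [nhdsWithin_eq_map_subtype_coe p.2] at hVp
  obtain ⟨γ, hγ, hper, hmem, hH⟩ := h _ (Filter.inter_mem hVp' (Metric.ball_mem_nhds p hε))
  have hγV (θ : ℝ) : (γ θ : E) ∈ V ∩ Metric.ball (p : E) ε := (hmem θ).1
  refine ⟨ε, hε, fun θ => γ θ, by fun_prop, fun θ => ⟨hγV θ, fun h => (hmem θ).2 (Subtype.ext h)⟩,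
    fun q hq => ?_⟩
  have hconv : Convex ℝ (V ∩ Metric.ball (p : E) ε) := hV.inter (convex_ball _ _)
  have hin (a : I × ℝ) : AffineMap.lineMap q (γ a.2 : E) (a.1 : ℝ) ∈ V ∩ Metric.ball (p : E) ε :=
    hconv.segment_subset hq (hγV a.2)
      (by rw [segment_eq_image_lineMap]; exact ⟨_, a.1.2, rfl⟩)
  obtain ⟨a, ha⟩ := hH (fun a => ⟨AffineMap.lineMap q (γ a.2 : E) (a.1 : ℝ), hVS (hin a).1⟩)
    (by simp only [AffineMap.lineMap_apply_module]; fun_prop)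
    (fun θ => by simp) (fun θ => by simp) (fun t θ => by simp [hper])
  refine ⟨a.2, ?_⟩
  rw [segment_eq_image_lineMap]
  exact ⟨a.1, a.1.2, congrArg Subtype.val (ha (hεU (hin a).2))⟩

/-! ### Local structure of the dunce hat -/

lemma mul_exp_neg_mem_slitPlane {z : ℂ} {θ : ℝ}
    (h : 0 < z.re * Real.cos θ ∨ 0 < z.im * Real.sin θ) :
    z * Complex.exp (-(θ * Complex.I)) ∈ Complex.slitPlane := by
  obtain ⟨w, hw⟩ : ∃ w, w = z * Complex.exp (-(θ * Complex.I)) := ⟨_, rfl⟩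
  have hz : z = w * Complex.exp (θ * Complex.I) := by
    rw [hw, mul_assoc, ← Complex.exp_add, neg_add_cancel, Complex.exp_zero, mul_one]
  rw [← hw]
  by_contra hs
  rw [Complex.mem_slitPlane_iff] at hs
  push Not at hs
  rw [hz] at h
  simp only [Complex.mul_re, Complex.mul_im, Complex.exp_ofReal_mul_I_re,
    Complex.exp_ofReal_mul_I_im, hs.2, zero_mul, sub_zero, add_zero, mul_assoc] at h
  rcases h with h | h
  · nlinarith [mul_self_nonneg (Real.cos θ)]
  · nlinarith [mul_self_nonneg (Real.sin θ)]

/-- A criterion for essential loops by means of a pair of real functions with an isolated common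
zero and a parametrization whose composite with the pair is close to the identity of the plane. -/
lemma HasEssentialLoops.of_plane {X : Type*} [TopologicalSpace X] {R S : X → ℝ}
    (hR : Continuous R) (hS : Continuous S) {g : ℝ × ℝ → X} (hg : Continuous g)
    (hR0 : R (g 0) = 0) (hS0 : S (g 0) = 0)
    {U : Set X} (hU : U ∈ 𝓝 (g 0)) (hUx : ∀ y ∈ U, R y = 0 → S y = 0 → y = g 0)
    (hRS : ∀ᶠ p in 𝓝 (0 : ℝ × ℝ), p ≠ 0 → 0 < R (g p) * p.1 ∨ 0 < S (g p) * p.2) :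
    HasEssentialLoops (g 0) := by
  have hre (y : X) : ((R y : ℂ) + S y * Complex.I).re = R y := by simp
  have him (y : X) : ((R y : ℂ) + S y * Complex.I).im = S y := by simp
  refine .of_slitPlane (ρ := fun y => (R y : ℂ) + S y * Complex.I) (by fun_prop)
    (by simp [hR0, hS0]) hU (fun y hy h => hUx y hy ?_ ?_) fun N hN => ?_
  · rw [← hre, h, Complex.zero_re]
  · rw [← him, h, Complex.zero_im]
  obtain ⟨r, hr, hball⟩ := Metric.mem_nhds_iff.1
    (Filter.inter_mem (hg.continuousAt.preimage_mem_nhds hN) hRS)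
  refine ⟨fun θ => g (r / 2 * Real.cos θ, r / 2 * Real.sin θ), by fun_prop, fun θ => by simp,
    fun θ => ?_⟩
  have hmem : (r / 2 * Real.cos θ, r / 2 * Real.sin θ) ∈ Metric.ball (0 : ℝ × ℝ) r := by
    rw [mem_ball_zero_iff, Prod.norm_def, max_lt_iff, norm_mul, norm_mul, Real.norm_eq_abs,
      Real.norm_eq_abs, Real.norm_eq_abs, abs_of_pos (half_pos hr)]
    constructor
    · nlinarith [Real.abs_cos_le_one θ]
    · nlinarith [Real.abs_sin_le_one θ]
  refine ⟨(hball hmem).1, mul_exp_neg_mem_slitPlane ?_⟩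
  rw [hre, him]
  have hne : (r / 2 * Real.cos θ, r / 2 * Real.sin θ) ≠ (0 : ℝ × ℝ) := fun h => by
    simp only [Prod.mk_eq_zero, mul_eq_zero, (half_pos hr).ne', false_or] at h
    simpa [h.1, h.2] using Real.sin_sq_add_cos_sq θ
  refine ((hball hmem).2 hne).imp (fun h => ?_) (fun h => ?_)
  · refine pos_of_mul_pos_right (a := r / 2) ?_ (half_pos hr).le
    linarith
  · refine pos_of_mul_pos_right (a := r / 2) ?_ (half_pos hr).le
    linarith

/-- The function on the dunce hat induced by a function of the barycentric coordinates. -/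
def hatFun {Z : Type*} (P : ℝ → ℝ → ℝ → Z)
    (h : ∀ t, P (1 - t) t 0 = P 0 (1 - t) t ∧ P (1 - t) t 0 = P (1 - t) 0 t) : DunceHat → Z :=
  Quot.lift (fun y => P (y 0) (y 1) (y 2)) <| RespectsEdges.eq_of_dunceRel fun t ht => by
    simp only [coe_trianglePoint ht.1 le_rfl (by linarith [ht.2] : t + 0 ≤ 1),
      coe_trianglePoint (by linarith [ht.2] : 0 ≤ 1 - t) ht.1 (by linarith),
      coe_trianglePoint le_rfl ht.1 (by linarith [ht.2] : 0 + t ≤ 1)]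
    simpa using h t

lemma continuous_hatFun {Z : Type*} [TopologicalSpace Z] {P : ℝ → ℝ → ℝ → Z}
    {h : ∀ t, P (1 - t) t 0 = P 0 (1 - t) t ∧ P (1 - t) t 0 = P (1 - t) 0 t}
    (hP : Continuous fun p : ℝ × ℝ × ℝ => P p.1 p.2.1 p.2.2) : Continuous (hatFun P h) :=
  continuous_quot_lift _ (hP.comp ((continuous_triangle_coord 0).prodMk
    ((continuous_triangle_coord 1).prodMk (continuous_triangle_coord 2))))

lemma hatFun_hatPoint {Z : Type*} {P : ℝ → ℝ → ℝ → Z}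
    {h : ∀ t, P (1 - t) t 0 = P 0 (1 - t) t ∧ P (1 - t) t 0 = P (1 - t) 0 t} {a b : ℝ}
    (ha : 0 ≤ a) (hb : 0 ≤ b) (hab : a + b ≤ 1) :
    hatFun P h (hatPoint a b) = P (1 - a - b) a b := by
  change P (trianglePoint a b 0) (trianglePoint a b 1) (trianglePoint a b 2) = _
  rw [coe_trianglePoint ha hb hab]
  rfl

lemma eq_hatPoint (x : DunceHat) :
    (∃ a b, 0 < a ∧ 0 < b ∧ a + b < 1 ∧ x = hatPoint a b) ∨
      ∃ t ∈ Icc (0 : ℝ) 1, x = hatPoint t 0 := by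
  obtain ⟨y, rfl⟩ := Quot.exists_rep x
  have h0 := triangle_coord_nonneg y 0
  have h1 := triangle_coord_nonneg y 1
  have h2 := triangle_coord_nonneg y 2
  have hs := triangle_coord_sum y
  have hy : Quot.mk _ y = hatPoint (y 1) (y 2) := by rw [hatPoint, trianglePoint_coord]
  rw [hy]
  rcases h2.eq_or_lt with e2 | l2
  · exact .inr ⟨y 1, ⟨h1, by linarith⟩, by rw [← e2]⟩
  rcases h1.eq_or_lt with e1 | l1
  · exact .inr ⟨y 2, ⟨h2, by linarith⟩, by rw [← e1, (hatPoint_edge ⟨h2, by linarith⟩).2]⟩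
  rcases h0.eq_or_lt with e0 | l0
  · exact .inr ⟨y 2, ⟨h2, by linarith⟩, by
      rw [(hatPoint_edge ⟨h2, by linarith⟩).1]; congr 1; linarith⟩
  · exact .inl ⟨_, _, l1, l2, by linarith, rfl⟩

lemma eq_hatPoint_of_ne {x : DunceHat} (hx : x ≠ hatPoint 0 0) :
    (∃ a b, 0 < a ∧ 0 < b ∧ a + b < 1 ∧ x = hatPoint a b) ∨
      ∃ t, 0 < t ∧ t < 1 ∧ x = hatPoint t 0 := by
  refine (eq_hatPoint x).imp_right ?_
  rintro ⟨t, ht, rfl⟩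
  exact ⟨t, ht.1.lt_of_ne fun h => hx (by rw [← h]),
    ht.2.lt_of_ne fun h => hx (by rw [h, hatPoint_vertex.1]), rfl⟩

/-- A nonnegative function on the dunce hat whose zero set is the singular edge. -/
def hatInterior : DunceHat → ℝ :=
  hatFun (fun p q r => p * q * r) fun t => by simp

lemma continuous_hatInterior : Continuous hatInterior :=
  continuous_hatFun (by fun_prop)

lemma hatInterior_hatPoint {a b : ℝ} (ha : 0 ≤ a) (hb : 0 ≤ b) (hab : a + b ≤ 1) :
    hatInterior (hatPoint a b) = (1 - a - b) * a * b :=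
  hatFun_hatPoint ha hb hab

lemma hatInterior_edge {t : ℝ} (ht : t ∈ Icc (0 : ℝ) 1) : hatInterior (hatPoint t 0) = 0 := by
  rw [hatInterior_hatPoint ht.1 le_rfl (by linarith [ht.2]), mul_zero]

lemma hasEssentialLoops_hatPoint_interior {a b : ℝ} (ha : 0 < a) (hb : 0 < b)
    (hab : a + b < 1) : HasEssentialLoops (hatPoint a b) := by
  let R : DunceHat → ℝ := hatFun (fun p q r => p * q * r * (q - a)) fun t => by simp
  let S : DunceHat → ℝ := hatFun (fun p q r => p * q * r * (r - b)) fun t => by simp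
  let g : ℝ × ℝ → DunceHat := fun p => hatPoint (a + p.1) (b + p.2)
  have hg0 : g 0 = hatPoint a b := by simp [g]
  have hR {c d : ℝ} (hc : 0 < c) (hd : 0 < d) (hcd : c + d < 1) :
      R (hatPoint c d) = hatInterior (hatPoint c d) * (c - a) := by
    rw [hatInterior_hatPoint hc.le hd.le hcd.le]
    exact hatFun_hatPoint hc.le hd.le hcd.le
  have hS {c d : ℝ} (hc : 0 < c) (hd : 0 < d) (hcd : c + d < 1) :
      S (hatPoint c d) = hatInterior (hatPoint c d) * (d - b) := by
    rw [hatInterior_hatPoint hc.le hd.le hcd.le]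
    exact hatFun_hatPoint hc.le hd.le hcd.le
  have hpos {c d : ℝ} (hc : 0 < c) (hd : 0 < d) (hcd : c + d < 1) :
      0 < hatInterior (hatPoint c d) := by
    rw [hatInterior_hatPoint hc.le hd.le hcd.le]
    have : 0 < 1 - c - d := by linarith
    positivity
  rw [← hg0]
  refine .of_plane (R := R) (S := S) (continuous_hatFun (by fun_prop))
    (continuous_hatFun (by fun_prop)) (Continuous.hatPoint (by fun_prop) (by fun_prop))
    (by rw [hg0, hR ha hb hab, sub_self, mul_zero]) (by rw [hg0, hS ha hb hab, sub_self, mul_zero])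
    ((isOpen_lt continuous_const continuous_hatInterior).mem_nhds (hg0 ▸ hpos ha hb hab))
    (fun y hy hRy hSy => ?_) ?_
  · rcases eq_hatPoint y with ⟨c, d, hc, hd, hcd, rfl⟩ | ⟨t, ht, rfl⟩
    · rw [hR hc hd hcd] at hRy
      rw [hS hc hd hcd] at hSy
      rw [hg0, sub_eq_zero.1 ((mul_eq_zero.1 hRy).resolve_left (hpos hc hd hcd).ne'),
        sub_eq_zero.1 ((mul_eq_zero.1 hSy).resolve_left (hpos hc hd hcd).ne')]
    · exact absurd (hatInterior_edge ht) (ne_of_gt hy)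
  · have e1 : ∀ᶠ p : ℝ × ℝ in 𝓝 0, 0 < a + p.1 :=
      (by fun_prop : Continuous fun p : ℝ × ℝ => a + p.1).continuousAt.eventually_const_lt
        (by simpa using ha)
    have e2 : ∀ᶠ p : ℝ × ℝ in 𝓝 0, 0 < b + p.2 :=
      (by fun_prop : Continuous fun p : ℝ × ℝ => b + p.2).continuousAt.eventually_const_lt
        (by simpa using hb)
    have e3 : ∀ᶠ p : ℝ × ℝ in 𝓝 0, (a + p.1) + (b + p.2) < 1 :=
      (by fun_prop : Continuous fun p : ℝ × ℝ =>
        (a + p.1) + (b + p.2)).continuousAt.eventually_lt_const (by simpa using hab)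
    filter_upwards [e1, e2, e3] with p h1 h2 h3 hp
    have hk := hpos h1 h2 h3
    rw [hR h1 h2 h3, hS h1 h2 h3, add_sub_cancel_left, add_sub_cancel_left, mul_assoc, mul_assoc]
    by_cases hp1 : p.1 = 0
    · have hp2 : p.2 ≠ 0 := fun hp2 => hp (Prod.ext hp1 hp2)
      exact .inr (mul_pos hk (mul_self_pos.2 hp2))
    · exact .inl (mul_pos hk (mul_self_pos.2 hp1))

lemma hatPoint_edge_of_clamp (t : ℝ) : hatPoint t 0 = hatPoint (1 - t) t := by
  rcases lt_or_ge t 0 with h0 | h0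
  · have h1 : trianglePoint t 0 = trianglePoint 0 0 := Subtype.ext (by
      simp [trianglePoint, min_eq_right (h0.le.trans zero_le_one), max_eq_left h0.le])
    have h2 : trianglePoint (1 - t) t = trianglePoint 1 0 := Subtype.ext (by
      simp [trianglePoint, h0.le])
    rw [hatPoint, h1, hatPoint, h2]
    exact hatPoint_vertex.1.symm
  rcases lt_or_ge 1 t with h1 | h1
  · have e1 : trianglePoint t 0 = trianglePoint 1 0 := Subtype.ext (by
      simp [trianglePoint, min_eq_left h1.le])
    have e2 : trianglePoint (1 - t) t = trianglePoint 0 1 := Subtype.ext (by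
      simp [trianglePoint, min_eq_right (by linarith : 1 - t ≤ 1),
        max_eq_left (by linarith : 1 - t ≤ 0), min_eq_left h1.le])
    rw [hatPoint, e1, hatPoint, e2]
    exact hatPoint_vertex.1.trans hatPoint_vertex.2.symm
  · exact (hatPoint_edge ⟨h0, h1⟩).1

lemma hasEssentialLoops_hatPoint_edge {t : ℝ} (h0 : 0 < t) (h1 : t < 1) :
    HasEssentialLoops (hatPoint t 0) := by
  -- `κ` distinguishes the sheets along the edge, and `|κ|` is well defined on the dunce hat
  let κ : ℝ → ℝ → ℝ → ℝ := fun p q r => p * q - r * (p + q)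
  let A : DunceHat → ℝ := hatFun (fun p q r => |κ p q r|) fun t => by
    simp only [κ]; constructor
    · rw [← abs_neg]; congr 1; ring
    · rw [← abs_neg]; congr 1; ring
  let R : DunceHat → ℝ := hatFun
    (fun p q r => p * q * (q - t) + q * r * (r - t) + p * r * (r - t)) fun t => by
      constructor <;> ring
  let S : DunceHat → ℝ := hatFun (fun p q r => p * q * r * κ p q r) fun t => by simp
  let g : ℝ × ℝ → DunceHat := fun p =>
    if 0 ≤ p.2 then hatPoint (t + p.1) p.2 else hatPoint (1 - (t + p.1) + p.2) (t + p.1)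
  have hg : Continuous g := by
    refine Continuous.if_le (Continuous.hatPoint (by fun_prop) (by fun_prop))
      (Continuous.hatPoint (by fun_prop) (by fun_prop)) (by fun_prop) (by fun_prop)
      fun p hp => ?_
    rw [← hp, add_zero]
    exact hatPoint_edge_of_clamp _
  have hg0 : g 0 = hatPoint t 0 := by simp [g]
  have hA : A (hatPoint t 0) = (1 - t) * t := by
    simp only [A, κ]
    rw [hatFun_hatPoint h0.le le_rfl (by linarith)]
    simp only [sub_zero, zero_mul]
    exact abs_of_pos (mul_pos (by linarith) h0)
  have hRe {u : ℝ} (hu : u ∈ Icc (0 : ℝ) 1) : R (hatPoint u 0) = (1 - u) * u * (u - t) := by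
    simp only [R]
    rw [hatFun_hatPoint hu.1 le_rfl (by linarith [hu.2])]
    ring
  have hS {a b : ℝ} (ha : 0 ≤ a) (hb : 0 ≤ b) (hab : a + b ≤ 1) :
      S (hatPoint a b) = (1 - a - b) * a * b * κ (1 - a - b) a b := hatFun_hatPoint ha hb hab
  rw [← hg0]
  refine .of_plane (R := R) (S := S) (continuous_hatFun (by fun_prop))
    (continuous_hatFun (by fun_prop)) hg ?_ ?_
    ((isOpen_lt (f := fun _ => (0 : ℝ)) (g := A) continuous_const
      (continuous_hatFun (by fun_prop))).mem_nhds ?_)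
    (fun y hy hRy hSy => ?_) ?_
  · rw [hg0, hRe ⟨h0.le, h1.le⟩, sub_self, mul_zero]
  · rw [hg0, hS h0.le le_rfl (by linarith), mul_zero, zero_mul]
  · rw [mem_ofPred_eq, hg0, hA]
    exact mul_pos (by linarith) h0
  · rcases eq_hatPoint y with ⟨c, d, hc, hd, hcd, rfl⟩ | ⟨u, hu, rfl⟩
    · simp only [A] at hy
      rw [mem_ofPred_eq, hatFun_hatPoint hc.le hd.le hcd.le, abs_pos] at hy
      rw [hS hc.le hd.le hcd.le] at hSy
      have : 0 < 1 - c - d := by linarith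
      exact absurd hSy (by positivity)
    · rw [hRe hu, mul_eq_zero, sub_eq_zero] at hRy
      rcases hRy with h | h
      · simp only [A, κ] at hy
        rw [mem_ofPred_eq, hatFun_hatPoint hu.1 le_rfl (by linarith [hu.2])] at hy
        simp [h] at hy
      · rw [hg0, h]
  · have ev {f : ℝ × ℝ → ℝ} (hf : Continuous f) (hf0 : 0 < f 0) : ∀ᶠ p in 𝓝 0, 0 < f p :=
      hf.continuousAt.eventually_const_lt hf0
    filter_upwards [ev (f := fun p => t + p.1) (by fun_prop) (by simpa using h0),
      ev (f := fun p => 1 - (t + p.1)) (by fun_prop) (by simpa using h1),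
      ev (f := fun p => 1 - (t + p.1) - p.2) (by fun_prop) (by simpa using h1),
      ev (f := fun p => 1 - (t + p.1) + p.2) (by fun_prop) (by simpa using h1),
      ev (f := fun p => κ (1 - (t + p.1) - p.2) (t + p.1) p.2) (by fun_prop)
        (by simpa [κ] using mul_pos (sub_pos.2 h1) h0),
      ev (f := fun p => -κ (-p.2) (1 - (t + p.1) + p.2) (t + p.1)) (by fun_prop)
        (by simpa [κ] using mul_pos h0 (sub_pos.2 h1))] with p p1 p2 p3 p4 p5 p6 hp
    rcases lt_trichotomy p.2 0 with hv | hv | hv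
    · right
      have hgp : g p = hatPoint (1 - (t + p.1) + p.2) (t + p.1) := if_neg hv.not_ge
      have e : 1 - (1 - (t + p.1) + p.2) - (t + p.1) = -p.2 := by ring
      rw [hgp, hS p4.le p1.le (by linarith), e]
      have := mul_pos (mul_pos (mul_pos p4 p1) p6) (mul_self_pos.2 hv.ne)
      linarith
    · left
      have hgp : g p = hatPoint (t + p.1) 0 := by simp [g, hv]
      rw [hgp, hRe ⟨p1.le, by linarith⟩, add_sub_cancel_left, mul_assoc]
      exact mul_pos (mul_pos p2 p1) (mul_self_pos.2 fun h => hp (Prod.ext h hv))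
    · right
      have hgp : g p = hatPoint (t + p.1) p.2 := if_pos hv.le
      rw [hgp, hS p1.le hv.le (by linarith)]
      positivity

lemma hasEssentialLoops_of_ne {x : DunceHat} (hx : x ≠ hatPoint 0 0) : HasEssentialLoops x := by
  rcases eq_hatPoint_of_ne hx with ⟨a, b, ha, hb, hab, rfl⟩ | ⟨t, h0, h1, rfl⟩
  · exact hasEssentialLoops_hatPoint_interior ha hb hab
  · exact hasEssentialLoops_hatPoint_edge h0 h1

lemma exists_injOn_hatInterior_pos :
    ∃ G : DunceHat → ℂ, ContinuousOn G {x | 0 < hatInterior x} ∧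
      InjOn G {x | 0 < hatInterior x} := by
  let R : DunceHat → ℝ := hatFun (fun p q r => p * q * r * q) fun t => by simp
  let S : DunceHat → ℝ := hatFun (fun p q r => p * q * r * r) fun t => by simp
  have hR : Continuous R := continuous_hatFun (by fun_prop)
  have hS : Continuous S := continuous_hatFun (by fun_prop)
  let G : DunceHat → ℂ := fun x =>
    ((R x / hatInterior x : ℝ) : ℂ) + ((S x / hatInterior x : ℝ) : ℂ) * Complex.I
  have hG {x : DunceHat} (hx : 0 < hatInterior x) :
      x = hatPoint (G x).re (G x).im := by
    have hre : (G x).re = R x / hatInterior x := by simp [G]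
    have him : (G x).im = S x / hatInterior x := by simp [G]
    rcases eq_hatPoint x with ⟨a, b, ha, hb, hab, rfl⟩ | ⟨t, ht, rfl⟩
    · have hRx : R (hatPoint a b) = hatInterior (hatPoint a b) * a := by
        rw [hatInterior_hatPoint ha.le hb.le hab.le]
        exact hatFun_hatPoint ha.le hb.le hab.le
      have hSx : S (hatPoint a b) = hatInterior (hatPoint a b) * b := by
        rw [hatInterior_hatPoint ha.le hb.le hab.le]
        exact hatFun_hatPoint ha.le hb.le hab.le
      rw [hre, him, hRx, hSx, mul_div_cancel_left₀ _ hx.ne', mul_div_cancel_left₀ _ hx.ne']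
    · exact absurd (hatInterior_edge ht) hx.ne'
  refine ⟨G, ?_, fun x hx y hy h => by rw [hG hx, hG hy, h]⟩
  have h1 : ContinuousOn (fun x => R x / hatInterior x) {x | 0 < hatInterior x} :=
    hR.continuousOn.div continuous_hatInterior.continuousOn fun x hx => ne_of_gt hx
  have h2 : ContinuousOn (fun x => S x / hatInterior x) {x | 0 < hatInterior x} :=
    hS.continuousOn.div continuous_hatInterior.continuousOn fun x hx => ne_of_gt hx
  exact (Complex.continuous_ofReal.comp_continuousOn h1).add
    ((Complex.continuous_ofReal.comp_continuousOn h2).mul continuousOn_const)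

lemma dense_hatInterior_pos : Dense {x | 0 < hatInterior x} := by
  intro x
  obtain ⟨a, b, ha, hb, hab, rfl⟩ : ∃ a b, 0 ≤ a ∧ 0 ≤ b ∧ a + b ≤ 1 ∧ x = hatPoint a b := by
    rcases eq_hatPoint x with ⟨a, b, ha, hb, hab, rfl⟩ | ⟨t, ht, rfl⟩
    · exact ⟨a, b, ha.le, hb.le, hab.le, rfl⟩
    · exact ⟨t, 0, ht.1, le_rfl, by linarith [ht.2], rfl⟩
  have hc : Continuous fun u : ℝ => hatPoint ((1 - u) * a + u / 3) ((1 - u) * b + u / 3) :=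
    Continuous.hatPoint (by fun_prop) (by fun_prop)
  refine mem_closure_of_tendsto (b := 𝓝[>] (0 : ℝ))
    ((hc.tendsto' 0 (hatPoint a b) (by simp)).mono_left nhdsWithin_le_nhds) ?_
  filter_upwards [Ioo_mem_nhdsGT (zero_lt_one : (0 : ℝ) < 1)] with u hu
  have e1 : 0 < (1 - u) * a + u / 3 := by
    have := mul_nonneg (sub_nonneg.2 hu.2.le) ha
    linarith [hu.1]
  have e2 : 0 < (1 - u) * b + u / 3 := by
    have := mul_nonneg (sub_nonneg.2 hu.2.le) hb
    linarith [hu.1]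
  have e3 : 0 < 1 - ((1 - u) * a + u / 3) - ((1 - u) * b + u / 3) := by
    have := mul_nonneg (sub_nonneg.2 hu.2.le) (sub_nonneg.2 hab)
    nlinarith [hu.1]
  rw [hatInterior_hatPoint e1.le e2.le (by linarith)]
  positivity

instance : Nontrivial DunceHat := by
  obtain ⟨x, hx⟩ := dense_hatInterior_pos.nonempty_iff.2 ⟨hatPoint 0 0⟩
  refine ⟨x, hatPoint 0 0, fun h => ?_⟩
  rw [mem_ofPred_eq, h, hatInterior_edge (by simp)] at hx
  exact lt_irrefl _ hx

/-! ### Open stars in simplicial complexes -/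

section OpenStar

variable {E : Type*} [NormedAddCommGroup E] [NormedSpace ℝ E]

/-- The points of the simplex spanned by `T` whose barycentric coordinates with respect to the
vertices in `s` are positive. -/
def openStar (s T : Finset E) : Set E :=
  {y | ∃ w : E → ℝ, (∀ x ∈ T, 0 ≤ w x) ∧ (∀ x ∈ s, 0 < w x) ∧ ∑ x ∈ T, w x = 1 ∧
    ∑ x ∈ T, w x • x = y}

lemma AffineIndependent.eq_of_sum_smul_eq {T : Finset E}
    (hT : AffineIndependent ℝ ((↑) : T → E)) {w w' : E → ℝ}
    (h : ∑ x ∈ T, w x = ∑ x ∈ T, w' x) (h' : ∑ x ∈ T, w x • x = ∑ x ∈ T, w' x • x) :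
    ∀ x ∈ T, w x = w' x := fun x hx => by
  have := affineIndependent_iff.1 hT Finset.univ (fun x => w x - w' x)
    (by rw [Finset.sum_sub_distrib, Finset.sum_coe_sort T w, Finset.sum_coe_sort T w', h, sub_self])
    (by
      simp only [sub_smul]
      rw [Finset.sum_sub_distrib, Finset.sum_coe_sort T fun x => w x • x,
        Finset.sum_coe_sort T fun x => w' x • x, h', sub_self]) ⟨x, hx⟩ (Finset.mem_univ _)
  exact sub_eq_zero.1 this

lemma openStar_subset_convexHull (s T : Finset E) : openStar s T ⊆ convexHull ℝ (T : Set E) := by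
  rintro y ⟨w, h0, -, h1, h⟩
  exact Finset.mem_convexHull'.2 ⟨w, h0, h1, h⟩

lemma convex_openStar (s T : Finset E) : Convex ℝ (openStar s T) := by
  rintro _ ⟨w, h0, hs, h1, rfl⟩ _ ⟨w', h0', hs', h1', rfl⟩ a b ha hb hab
  refine ⟨fun x => a * w x + b * w' x, fun x hx => ?_, fun x hx => ?_, ?_, ?_⟩
  · have := h0 x hx
    have := h0' x hx
    positivity
  · exact convex_Ioi (0 : ℝ) (hs x hx) (hs' x hx) ha hb hab
  · rw [Finset.sum_add_distrib, ← Finset.mul_sum, ← Finset.mul_sum, h1, h1', mul_one, mul_one, hab]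
  · simp only [add_smul, mul_smul, Finset.sum_add_distrib, Finset.smul_sum]

lemma exists_weight_extension {u T : Finset E} (hu : u ⊆ T) (w : E → ℝ) :
    ∃ w' : E → ℝ, (∀ x ∈ u, w' x = w x) ∧ (∀ x ∉ u, w' x = 0) ∧
      ∑ x ∈ T, w' x = ∑ x ∈ u, w x ∧ ∑ x ∈ T, w' x • x = ∑ x ∈ u, w x • x := by
  classical
  obtain ⟨w', hw'⟩ : ∃ w' : E → ℝ, ∀ x, w' x = if x ∈ u then w x else 0 := ⟨_, fun _ => rfl⟩
  have h1 : ∀ x ∈ u, w' x = w x := fun x hx => by rw [hw', if_pos hx]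
  have h0 : ∀ x ∉ u, w' x = 0 := fun x hx => by rw [hw', if_neg hx]
  refine ⟨w', h1, h0, ?_, ?_⟩
  · rw [← Finset.sum_subset hu fun x _ hx => h0 x hx]
    exact Finset.sum_congr rfl h1
  · rw [← Finset.sum_subset hu fun x _ hx => by rw [h0 x hx, zero_smul]]
    exact Finset.sum_congr rfl fun x hx => by rw [h1 x hx]

lemma exists_weight_of_mem_convexHull {u T : Finset E} (hu : u ⊆ T) {y : E}
    (hy : y ∈ convexHull ℝ (u : Set E)) :
    ∃ w : E → ℝ, (∀ x ∈ T, 0 ≤ w x) ∧ (∀ x ∉ u, w x = 0) ∧ ∑ x ∈ T, w x = 1 ∧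
      ∑ x ∈ T, w x • x = y := by
  obtain ⟨w, h0, h1, h⟩ := Finset.mem_convexHull'.1 hy
  obtain ⟨w', hw, hw0, hw1, hw'⟩ := exists_weight_extension hu w
  refine ⟨w', fun x _ => ?_, hw0, hw1.trans h1, hw'.trans h⟩
  by_cases hx : x ∈ u
  · exact (hw x hx).symm ▸ h0 x hx
  · exact (hw0 x hx).ge

lemma openStar_mem_nhdsWithin {K : SimplicialComplex ℝ E} (hK : K.faces.Finite)
    {s T : Finset E} (hT : T ∈ K.faces) (hsT : s ⊆ T) (hmax : ∀ u ∈ K.faces, s ⊆ u → u ⊆ T)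
    {p : E} (hp : p ∈ openStar s T) : openStar s T ∈ 𝓝[K.space] p := by
  classical
  let C : Set E := ⋃ t ∈ {t ∈ K.faces | ¬ s ⊆ t}, convexHull ℝ (t : Set E)
  have hC : IsClosed C := (hK.subset (sep_subset _ _)).isClosed_biUnion fun t _ =>
    t.finite_toSet.isClosed_convexHull ℝ
  refine mem_nhdsWithin.2 ⟨Cᶜ, hC.isOpen_compl, fun hpC => ?_, ?_⟩
  · obtain ⟨t, ⟨ht, hst⟩, hpt⟩ := mem_iUnion₂.1 hpC
    have hpT := K.inter_subset_convexHull hT ht ⟨openStar_subset_convexHull _ _ hp, hpt⟩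
    rw [← Finset.coe_inter] at hpT
    obtain ⟨w, -, hs, h1, h⟩ := hp
    obtain ⟨w', -, h0', h1', h'⟩ := exists_weight_of_mem_convexHull Finset.inter_subset_left hpT
    obtain ⟨x, hxs, hxt⟩ := Finset.not_subset.1 hst
    have := (K.indep hT).eq_of_sum_smul_eq (h1.trans h1'.symm) (h.trans h'.symm) x (hsT hxs)
    rw [h0' x fun hx => hxt (Finset.mem_inter.1 hx).2] at this
    exact (hs x hxs).ne' this
  · rintro y ⟨hyC, hy⟩
    obtain ⟨u, hu, hyu⟩ := K.mem_space_iff.1 hy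
    have hyC' : ∀ t ∈ K.faces, y ∈ convexHull ℝ (t : Set E) → s ⊆ t := fun t ht hyt => by
      by_contra hst
      exact hyC (mem_iUnion₂.2 ⟨t, ⟨ht, hst⟩, hyt⟩)
    have hsu := hyC' u hu hyu
    have huT := hmax u hu hsu
    obtain ⟨w, h0, hu0, h1, h⟩ := exists_weight_of_mem_convexHull huT hyu
    refine ⟨w, h0, fun x hx => (h0 x (hsT hx)).lt_of_ne fun hx0 => ?_, h1, h⟩
    have hye : y ∈ convexHull ℝ ((u.erase x : Finset E) : Set E) := by
      have hz : ∀ z ∈ T, z ∉ u.erase x → w z = 0 := fun z _ hz => by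
        by_cases hzx : z = x
        · rw [hzx, hx0]
        · exact hu0 z fun hzu => hz (Finset.mem_erase.2 ⟨hzx, hzu⟩)
      have hsub : u.erase x ⊆ T := (Finset.erase_subset _ _).trans huT
      refine Finset.mem_convexHull'.2 ⟨w, fun z hz => h0 z (hsub hz), ?_, ?_⟩
      · rw [← h1, Finset.sum_subset hsub hz]
      · rw [← h, Finset.sum_subset hsub fun z hzT hzu => by rw [hz z hzT hzu, zero_smul]]
    have hne : (u.erase x).Nonempty :=
      Finset.coe_nonempty.1 (convexHull_nonempty_iff.1 ⟨y, hye⟩)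
    exact Finset.notMem_erase x u
      (hyC' _ (K.down_closed hu (Finset.erase_subset _ _) hne) hye hx)

lemma nonempty_openStar_self {T : Finset E} (hT : T.Nonempty) : (openStar T T).Nonempty := by
  have hc : (0 : ℝ) < T.card := by exact_mod_cast hT.card_pos
  exact ⟨_, fun _ => (T.card : ℝ)⁻¹, fun x _ => by positivity, fun x _ => by positivity,
    by simp [hc.ne'], rfl⟩

lemma exists_weight_of_mem_openStar_self {s T : Finset E} (h : s ⊆ T) {y : E}
    (hy : y ∈ openStar s s) :
    ∃ w : E → ℝ, (∀ x ∈ T, 0 ≤ w x) ∧ (∀ x ∈ s, 0 < w x) ∧ (∀ x ∉ s, w x = 0) ∧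
      ∑ x ∈ T, w x = 1 ∧ ∑ x ∈ T, w x • x = y := by
  obtain ⟨w, h0, hs, h1, hw⟩ := hy
  obtain ⟨w', hws, hw0, hw1, hw'⟩ := exists_weight_extension h w
  refine ⟨w', fun x _ => ?_, fun x hx => hws x hx ▸ hs x hx, hw0, hw1.trans h1, hw'.trans hw⟩
  by_cases hx : x ∈ s
  · exact (hws x hx).symm ▸ h0 x hx
  · exact (hw0 x hx).ge

lemma openStar_self_subset {s T : Finset E} (h : s ⊆ T) : openStar s s ⊆ openStar s T :=
  fun _ hy =>
    let ⟨w, h0, hs, _, h1, hw⟩ := exists_weight_of_mem_openStar_self h hy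
    ⟨w, h0, hs, h1, hw⟩

end OpenStar

/-! ### Triangulations of the dunce hat -/

section Triangulation

variable {E : Type*} [NormedAddCommGroup E] [NormedSpace ℝ E] {K : SimplicialComplex ℝ E}

lemma exists_facet_of_ncard_lt_two {s : Finset E} (hK : K.faces.Finite) (hs : s ∈ K.faces)
    (hs2 : s.card = 2) (h : {t | t ∈ K.faces ∧ s ⊂ t ∧ t.card = 3}.ncard < 2) :
    ∃ T ∈ K.faces, s ⊆ T ∧ (∀ u ∈ K.faces, s ⊆ u → u ⊆ T) ∧
      (T = s ∨ ∃ c ∈ T, c ∉ s) := by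
  classical
  have hfin : {t | t ∈ K.faces ∧ s ⊂ t ∧ t.card = 3}.Finite := hK.subset fun t ht => ht.1
  have huniq := (Set.ncard_le_one hfin).1 (Nat.lt_succ_iff.1 h)
  have hins {u : Finset E} (hu : u ∈ K.faces) (hsu : s ⊆ u) {c : E} (hc : c ∈ u) (hcs : c ∉ s) :
      insert c s ∈ {t | t ∈ K.faces ∧ s ⊂ t ∧ t.card = 3} :=
    ⟨K.down_closed hu (Finset.insert_subset hc hsu) (Finset.insert_nonempty _ _),
      Finset.ssubset_insert hcs, by rw [Finset.card_insert_of_notMem hcs, hs2]⟩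
  rcases Set.eq_empty_or_nonempty {t | t ∈ K.faces ∧ s ⊂ t ∧ t.card = 3} with he | ⟨T, hT⟩
  · refine ⟨s, hs, subset_rfl, fun u hu hsu c hc => ?_, .inl rfl⟩
    by_contra hcs
    exact (he ▸ hins hu hsu hc hcs : insert c s ∈ (∅ : Set (Finset E)))
  · obtain ⟨c, hc⟩ := Finset.exists_of_ssubset hT.2.1
    refine ⟨T, hT.1, hT.2.1.subset, fun u hu hsu c hc => ?_, .inr ⟨c, hc⟩⟩
    by_cases hcs : c ∈ s
    · exact hT.2.1.subset hcs
    · rw [huniq T hT _ (hins hu hsu hc hcs)]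
      exact Finset.mem_insert_self _ _

/-- If a simplex `T` contains an edge `s` and all simplices around `s`, then the interior points
of `s` are not encircled by essential loops when `T` has a further vertex. -/
lemma not_hasEssentialLoops_of_notMem {s T : Finset E} (hK : K.faces.Finite) (hT : T ∈ K.faces)
    (hsT : s ⊆ T) (hmax : ∀ u ∈ K.faces, s ⊆ u → u ⊆ T) {c : E} (hcT : c ∈ T) (hcs : c ∉ s)
    {p : K.space} (hp : (p : E) ∈ openStar s s) : ¬ HasEssentialLoops p := by
  classical
  intro hloop
  obtain ⟨ε, hε, γ, -, hγ, hseg⟩ := hloop.exists_mem_segment (convex_openStar s T)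
    ((openStar_subset_convexHull s T).trans (K.convexHull_subset_space hT))
    (openStar_mem_nhdsWithin hK hT hsT hmax (openStar_self_subset hsT hp))
  obtain ⟨w, h0, hs0, hw0, h1, hw⟩ := exists_weight_of_mem_openStar_self hsT hp
  obtain ⟨δ, hδ, hδ1, hball⟩ : ∃ δ : ℝ, 0 < δ ∧ δ < 1 ∧
      (1 - δ) • (p : E) + δ • c ∈ Metric.ball (p : E) ε := by
    have hc : Continuous fun δ : ℝ => (1 - δ) • (p : E) + δ • c := by fun_prop
    obtain ⟨δ, h, h'⟩ := (((hc.tendsto' 0 (p : E) (by simp)).mono_left nhdsWithin_le_nhds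
      |>.eventually_mem (Metric.ball_mem_nhds _ hε)).and (Ioo_mem_nhdsGT zero_lt_one)).exists
    exact ⟨δ, h'.1, h'.2, h⟩
  let v : E → ℝ := fun x => (1 - δ) * w x + δ * if x = c then 1 else 0
  have hv0 : ∀ x ∈ T, 0 ≤ v x := fun x hx => by
    have := mul_nonneg (sub_nonneg.2 hδ1.le) (h0 x hx)
    simp only [v]
    split_ifs <;> linarith
  have hv1 : ∑ x ∈ T, v x = 1 := by
    simp only [v, Finset.sum_add_distrib, ← Finset.mul_sum, h1, Finset.sum_ite_eq', hcT, if_true]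
    ring
  have hv : ∑ x ∈ T, v x • x = (1 - δ) • (p : E) + δ • c := by
    simp only [v, add_smul, mul_smul, Finset.sum_add_distrib, ← Finset.smul_sum, hw, ite_smul,
      one_smul, zero_smul, Finset.sum_ite_eq', hcT, if_true]
  have hvs : ∀ x ∈ s, 0 < v x := fun x hx => by
    have := mul_pos (sub_pos.2 hδ1) (hs0 x hx)
    simp only [v]
    split_ifs <;> linarith
  obtain ⟨θ, a, b, ha, hb, hab, h⟩ := hseg _ ⟨⟨v, hv0, hvs, hv1, hv⟩, hball⟩
  obtain ⟨w', h0', -, h1', hw'⟩ := (hγ θ).1.1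
  have key := (K.indep hT).eq_of_sum_smul_eq (w := fun x => a * v x + b * w' x) (w' := w)
    (by rw [Finset.sum_add_distrib, ← Finset.mul_sum, ← Finset.mul_sum, hv1, h1', h1]; linarith)
    (by simp only [add_smul, mul_smul, Finset.sum_add_distrib, ← Finset.smul_sum, hv, hw', hw, h])
    c hcT
  have hvc : v c = δ := by simp [v, hw0 c hcs]
  rw [hw0 c hcs, hvc] at key
  have ha0 : a = 0 := by
    have := mul_nonneg hb (h0' c hcT)
    have := mul_nonneg ha hδ.le
    exact (mul_eq_zero.1 (by linarith : a * δ = 0)).resolve_right hδ.ne'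
  rw [ha0, zero_add] at hab
  rw [ha0, hab, zero_smul, one_smul, zero_add] at h
  exact (hγ θ).2 h

/-- The interior points of a maximal edge are not encircled by essential loops. -/
lemma not_hasEssentialLoops_of_card_eq_two {s : Finset E} (hK : K.faces.Finite)
    (hs : s ∈ K.faces) (hs2 : s.card = 2) (hmax : ∀ u ∈ K.faces, s ⊆ u → u ⊆ s)
    {p : K.space} (hp : (p : E) ∈ openStar s s) : ¬ HasEssentialLoops p := by
  classical
  intro hloop
  obtain ⟨ε, hε, γ, hγc, hγ, hseg⟩ := hloop.exists_mem_segment (convex_openStar s s)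
    ((openStar_subset_convexHull s s).trans (K.convexHull_subset_space hs))
    (openStar_mem_nhdsWithin hK hs subset_rfl hmax hp)
  obtain ⟨a, b, hab, rfl⟩ := Finset.card_eq_two.1 hs2
  obtain ⟨f, hf⟩ := geometric_hahn_banach_point_point hab
  have hinj : InjOn f (openStar {a, b} {a, b}) := by
    rintro _ ⟨w, -, -, h1, rfl⟩ _ ⟨w', -, -, h1', rfl⟩ h
    rw [Finset.sum_pair hab] at h1 h1'
    simp only [Finset.sum_pair hab, map_add, map_smul, smul_eq_mul] at h ⊢
    have : w a = w' a := by
      rw [← sub_eq_zero]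
      refine (mul_eq_zero.1 (?_ : (w a - w' a) * (f a - f b) = 0)).resolve_right
        (sub_neg.2 hf).ne
      linear_combination h - f b * h1 + f b * h1'
    rw [this, show w b = w' b by linarith]
  have hne (θ : ℝ) : f (γ θ) - f p ≠ 0 := fun h =>
    (hγ θ).2 (hinj (hγ θ).1.1 hp (sub_eq_zero.1 h))
  have hsign (θ : ℝ) : 0 < (f (γ 0) - f p) * (f (γ θ) - f p) := by
    by_contra! hle
    obtain ⟨θ', hθ'⟩ := mem_range_of_exists_le_of_exists_ge
      (f := fun θ => (f (γ 0) - f p) * (f (γ θ) - f p)) (c := 0) (by fun_prop) ⟨θ, hle⟩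
      ⟨0, mul_self_nonneg _⟩
    exact mul_ne_zero (hne 0) (hne θ') hθ'
  obtain ⟨θ, α, β, hα, hβ, hαβ, h⟩ := hseg (γ 0) (hγ 0).1
  have h := congrArg f h
  simp only [map_add, map_smul, smul_eq_mul] at h
  have hsum : α * ((f (γ 0) - f p) * (f (γ 0) - f p)) +
      β * ((f (γ 0) - f p) * (f (γ θ) - f p)) = 0 := by
    linear_combination (f (γ 0) - f p) * (h - f p * hαβ)
  have h1 := mul_nonneg hα (hsign 0).le
  have h2 := mul_nonneg hβ (hsign θ).le
  have e1 := (mul_eq_zero.1 (by linarith : α * _ = 0)).resolve_right (hsign 0).ne'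
  have e2 := (mul_eq_zero.1 (by linarith : β * _ = 0)).resolve_right (hsign θ).ne'
  linarith

/-- The Euclidean space of dimension three embeds in a space containing a simplex with
at least four vertices. -/
lemma exists_continuous_injective_of_four_le_card {T : Finset E}
    (hT : AffineIndependent ℝ ((↑) : T → E)) (hcard : 4 ≤ T.card) {p : E}
    (hp : p ∈ openStar T T) :
    ∃ L : ℝ × ℝ × ℝ → E, Continuous L ∧ Function.Injective L ∧ L 0 = p ∧
      ∀ᶠ z in 𝓝 0, L z ∈ openStar T T := by
  classical
  obtain ⟨w, h0, hpos, h1, hw⟩ := hp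
  obtain ⟨t, htT, ht⟩ := Finset.exists_subset_card_eq hcard
  obtain ⟨a, b, c, d, hab, hac, had, hbc, hbd, hcd, rfl⟩ := Finset.card_eq_four.1 ht
  simp only [Finset.insert_subset_iff, Finset.singleton_subset_iff] at htT
  obtain ⟨haT, hbT, hcT, hdT⟩ := htT
  let v : ℝ × ℝ × ℝ → E → ℝ := fun z x => w x + (if x = a then z.1 else 0) +
    (if x = b then z.2.1 else 0) + (if x = c then z.2.2 else 0) -
    (if x = d then z.1 + z.2.1 + z.2.2 else 0)
  have hvc (x : E) : Continuous fun z => v z x := by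
    have hite {f : ℝ × ℝ × ℝ → ℝ} (hf : Continuous f) (y : E) :
        Continuous fun z => if x = y then f z else 0 := by
      split_ifs
      · exact hf
      · exact continuous_const
    exact (((continuous_const.add (hite (by fun_prop) a)).add (hite (by fun_prop) b)).add
      (hite (by fun_prop) c)).sub (hite (by fun_prop) d)
  have hv0 : v 0 = w := funext fun x => by simp [v]
  have hv1 (z : ℝ × ℝ × ℝ) : ∑ x ∈ T, v z x = 1 := by
    simp only [v, Finset.sum_sub_distrib, Finset.sum_add_distrib, Finset.sum_ite_eq', haT, hbT,
      hcT, hdT, if_true, h1]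
    ring
  refine ⟨fun z => ∑ x ∈ T, v z x • x,
    continuous_finsetSum _ fun x _ => (hvc x).smul continuous_const, fun z z' h => ?_,
    by simp only [hv0, hw], ?_⟩
  · have key := hT.eq_of_sum_smul_eq ((hv1 z).trans (hv1 z').symm) h
    refine Prod.ext ?_ (Prod.ext ?_ ?_)
    · simpa [v, hab, hac, had] using key a haT
    · simpa [v, hab.symm, hbc, hbd] using key b hbT
    · simpa [v, hac.symm, hbc.symm, hcd] using key c hcT
  · have : ∀ᶠ z in 𝓝 (0 : ℝ × ℝ × ℝ), ∀ x ∈ T, 0 < v z x :=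
      (Finset.eventually_all T).2 fun x hx =>
        (hvc x).continuousAt.eventually_const_lt (by simpa only [hv0] using hpos x hx)
    filter_upwards [this] with z hz
    exact ⟨v z, fun x hx => (hz x hx).le, hz, hv1 z, rfl⟩

lemma card_lt_four_of_facet (h : K.space ≃ₜ DunceHat) {T : Finset E} (hK : K.faces.Finite) (hT : T ∈ K.faces)
    (hmax : ∀ u ∈ K.faces, T ⊆ u → u ⊆ T) : T.card < 4 := by
  classical
  by_contra! hcard
  have hVs : openStar T T ⊆ K.space :=
    (openStar_subset_convexHull T T).trans (K.convexHull_subset_space hT)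
  obtain ⟨q, hq⟩ := nonempty_openStar_self (K.nonempty_of_mem_faces hT)
  have hVq : Subtype.val ⁻¹' openStar T T ∈ 𝓝 (⟨q, hVs hq⟩ : K.space) := by
    have := openStar_mem_nhdsWithin hK hT subset_rfl hmax hq
    rwa [nhdsWithin_eq_map_subtype_coe (hVs hq)] at this
  obtain ⟨x, hxV, hx⟩ := mem_closure_iff_nhds.1 (dense_hatInterior_pos (h ⟨q, hVs hq⟩))
    (h.symm ⁻¹' (Subtype.val ⁻¹' openStar T T))
    (h.symm.continuous.continuousAt.preimage_mem_nhds (by simpa using hVq))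
  obtain ⟨L, hLc, hLi, hL0, hLV⟩ :=
    exists_continuous_injective_of_four_le_card (K.indep hT) hcard hxV
  obtain ⟨G, hGc, hGi⟩ := exists_injOn_hatInterior_pos
  obtain ⟨O, hO, hOeq⟩ := isOpen_induced_iff.1
    ((isOpen_lt continuous_const continuous_hatInterior).preimage h.continuous)
  have hOmem {y : E} (hy : y ∈ K.space) : y ∈ O ↔ 0 < hatInterior (h ⟨y, hy⟩) :=
    Set.ext_iff.1 hOeq ⟨y, hy⟩
  let U : Set (ℝ × ℝ × ℝ) := {z | L z ∈ openStar T T ∧ L z ∈ O}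
  have hU : U ∈ 𝓝 0 := Filter.inter_mem hLV <|
    hLc.continuousAt.preimage_mem_nhds <| hO.mem_nhds <| by
      rw [hL0, hOmem (h.symm x).2]
      simpa using hx
  let F : ℝ × ℝ × ℝ → ℂ := fun z => if hz : L z ∈ K.space then G (h ⟨L z, hz⟩) else 0
  have hF (z : ℝ × ℝ × ℝ) (hz : z ∈ U) : F z = G (h ⟨L z, hVs hz.1⟩) := dif_pos (hVs hz.1)
  refine not_injOn_of_continuousOn_nhds hU (F := F) ?_ fun z hz z' hz' hzz' => ?_
  · rw [continuousOn_iff_continuous_domRestrict]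
    have : U.domRestrict F = fun z : U => G (h ⟨L z, hVs z.2.1⟩) := funext fun z => hF z z.2
    rw [this]
    exact hGc.comp_continuous (by fun_prop) fun z => (hOmem _).1 z.2.2
  · rw [hF z hz, hF z' hz'] at hzz'
    have := hGi ((hOmem _).1 hz.2) ((hOmem _).1 hz'.2) hzz'
    exact hLi (congrArg Subtype.val (h.injective this))

lemma two_le_ncard_triangles (h : K.space ≃ₜ DunceHat) {s : Finset E} (hK : K.faces.Finite)
    (hs : s ∈ K.faces) (hs2 : s.card = 2) : 2 ≤ {t | t ∈ K.faces ∧ s ⊂ t ∧ t.card = 3}.ncard := by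
  by_contra! hlt
  obtain ⟨T, hT, hsT, hmax, hTs⟩ := exists_facet_of_ncard_lt_two hK hs hs2 hlt
  obtain ⟨p, hp, hloop⟩ : ∃ p : K.space, (p : E) ∈ openStar s s ∧ HasEssentialLoops p := by
    classical
    obtain ⟨a, b, hab, rfl⟩ := Finset.card_eq_two.1 hs2
    have hVs : openStar {a, b} {a, b} ⊆ K.space :=
      (openStar_subset_convexHull _ _).trans (K.convexHull_subset_space hs)
    have hmem {α : ℝ} (h0 : 0 < α) (h1 : α < 1) :
        (1 - α) • a + α • b ∈ openStar {a, b} {a, b} := by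
      have hpos : ∀ x, 0 < if x = a then 1 - α else α := fun x => by split_ifs <;> linarith
      refine ⟨fun x => if x = a then 1 - α else α, fun x _ => (hpos x).le, fun x _ => hpos x, ?_,
        ?_⟩ <;> simp [Finset.sum_pair hab, hab.symm]
    have h2 := hmem (α := 1 / 2) (by norm_num) (by norm_num)
    have h3 := hmem (α := 1 / 3) (by norm_num) (by norm_num)
    by_contra! hno
    have hvert {y : E} (hy : y ∈ openStar {a, b} {a, b}) : h ⟨y, hVs hy⟩ = hatPoint 0 0 := by
      by_contra hne
      exact hno ⟨y, hVs hy⟩ hy (.of_homeomorph h (hasEssentialLoops_of_ne hne))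
    have heq := congrArg Subtype.val (h.injective ((hvert h2).trans (hvert h3).symm))
    have hsub : (1 / 6 : ℝ) • (b - a) = 0 := by
      rw [← sub_eq_zero.2 heq]
      module
    rw [smul_eq_zero, sub_eq_zero] at hsub
    exact hsub.elim (by norm_num) hab.symm
  rcases hTs with rfl | ⟨c, hcT, hcs⟩
  · exact not_hasEssentialLoops_of_card_eq_two hK hs hs2 hmax hp hloop
  · exact not_hasEssentialLoops_of_notMem hK hT hsT hmax hcT hcs hp hloop

lemma not_collapsesToPoint {E : Type} [NormedAddCommGroup E] [NormedSpace ℝ E]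
    {K : SimplicialComplex ℝ E} (h : K.space ≃ₜ DunceHat) (hK : K.faces.Finite) :
    ¬ CollapsesToPoint K.faces := by
  classical
  intro hcol
  obtain ⟨𝓕, h𝓕⟩ : ∃ 𝓕, 𝓕 = K.faces := ⟨_, rfl⟩
  rw [← h𝓕] at hcol
  cases hcol with
  | point v =>
    obtain ⟨x, y, hxy⟩ := h.toEquiv.nontrivial.exists_pair_ne
    have hv (z : K.space) : (z : E) = v := by
      obtain ⟨t, ht, hzt⟩ := K.mem_space_iff.1 z.2
      rw [← h𝓕, mem_singleton_iff] at ht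
      simpa [ht] using hzt
    exact hxy (Subtype.ext ((hv x).trans (hv y).symm))
  | step _ s t hs ht hst hfree _ =>
    subst h𝓕
    have ht4 := card_lt_four_of_facet h hK ht fun u hu htu =>
      (hfree u hu (hst.trans_subset htu)).subset
    have hs0 := (K.nonempty_of_mem_faces hs).card_pos
    have hlt := Finset.card_lt_card hst
    obtain ⟨u, hsu, hut, hu2⟩ := Finset.exists_subsuperset_card_eq hst.subset
      (by omega : s.card ≤ 2) (by omega : 2 ≤ t.card)
    have hu := K.down_closed ht hut (Finset.card_pos.1 (by omega))
    have hfin : {t | t ∈ K.faces ∧ u ⊂ t ∧ t.card = 3}.Finite := hK.subset fun t ht => ht.1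
    obtain ⟨t₁, h1, t₂, h2, hne⟩ := (Set.one_lt_ncard hfin).1 (two_le_ncard_triangles h hK hu hu2)
    exact hne ((hfree t₁ h1.1 (hsu.trans_ssubset h1.2.1)).trans
      (hfree t₂ h2.1 (hsu.trans_ssubset h2.2.1)).symm)

end Triangulation

/-- **The dunce hat is contractible but never collapsible.** The dunce hat is
contractible, but no (finite) triangulation of it is collapsible; indeed in any
triangulation every edge is a face of at least two triangles, so there is no free
face to start a collapse. -/
theorem dunceHat_contractible_and_no_triangulation_collapsible :
    ContractibleSpace DunceHat ∧
    ∀ (E : Type) [NormedAddCommGroup E] [NormedSpace ℝ E]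
      (K : SimplicialComplex ℝ E), K.faces.Finite →
      Nonempty (↥K.space ≃ₜ DunceHat) →
      (∀ s ∈ K.faces, s.card = 2 →
        2 ≤ {t | t ∈ K.faces ∧ s ⊂ t ∧ t.card = 3}.ncard) ∧
      ¬ CollapsesToPoint K.faces := by
  refine ⟨contractibleSpace_dunceHat, fun E _ _ K hK ⟨h⟩ => ⟨fun s hs hs2 => ?_, ?_⟩⟩
  · exact two_le_ncard_triangles h hK hs hs2
  · exact not_collapsesToPoint h hK
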